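/- arXiv:1509.02646 — 3 statements merged into one kernel-verified Lean document; each statement's English description precedes it below -/
import Mathlib

section
/- For every real a with 0 < a < 4/e there exists a constant M_a such that for every real c ≥ 1 and every integer n ≥ c·M_a one has λ_n(c) ≤ e^{−2n·ln(a·n/c)}; moreover, for every real b > 4/e there exists a constant M_b such that for every real c ≥ 1 and every integer n ≥ c·M_b one has λ_n(c) > e^{−2n·ln(b·n/c)}. -/
open MeasureTheory

/-- Complete Legendre elliptic integral of the second kind. -/
noncomputable def ellE (k : ℝ) : ℝ :=
  ∫ t in (0:ℝ)..1, Real.sqrt ((1 - k^2 * t^2) / (1 - t^2))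

/-- Complete Legendre elliptic integral of the first kind. -/
noncomputable def ellK (k : ℝ) : ℝ :=
  ∫ t in (0:ℝ)..1, 1 / Real.sqrt ((1 - t^2) * (1 - k^2 * t^2))

/-- The function `Ψ(k) = k / E(k)`. -/
noncomputable def PsiFn (k : ℝ) : ℝ := k / ellE k

/-- `Φ`, the inverse on `[0,1]` of the strictly increasing bijection `Ψ`. -/
noncomputable def PhiFn (x : ℝ) : ℝ :=
  sSup {y : ℝ | y ∈ Set.Icc (0:ℝ) 1 ∧ PsiFn y ≤ x}

/-- The function `𝒥(x) = (π²/4) ∫_{Φ(2x/π)}^1 dt/(t E(t)²)`. -/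
noncomputable def Jcal (x : ℝ) : ℝ :=
  (Real.pi^2 / 4) * ∫ t in PhiFn (2*x/Real.pi)..(1:ℝ), 1 / (t * (ellE t)^2)

/-- The function `𝒥_l(c) = (π/2) ∫_c^{πl/2} dτ/(Φ(2τ/(πl)) K(Φ(2τ/(πl))))`. -/
noncomputable def Jl (l c : ℝ) : ℝ :=
  (Real.pi / 2) * ∫ τ in c..(Real.pi * l / 2),
    1 / (PhiFn (2*τ/(Real.pi*l)) * ellK (PhiFn (2*τ/(Real.pi*l))))

/-- The approximation `λ̃_n(c)`. -/
noncomputable def lambdaTilde (n : ℕ) (c : ℝ) : ℝ :=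
  (1/2) * Real.exp (-(Real.pi^2 * ((n:ℝ) + 1/2) / 2) *
    ∫ t in PhiFn (2*c/(Real.pi*((n:ℝ)+1/2)))..(1:ℝ), 1 / (t * (ellE t)^2))

/-- The kernel `sin(c(x-y))/(π(x-y))`, with value `c/π` on the diagonal. -/
noncomputable def sincKernel (c x y : ℝ) : ℝ :=
  if x = y then c / Real.pi else Real.sin (c*(x-y)) / (Real.pi * (x-y))

/-- The quadratic form `⟨Q_c f, f⟩` of the time-and-frequency limiting operator `Q_c`. -/
noncomputable def QForm (c : ℝ) (f : ℝ → ℝ) : ℝ :=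
  ∫ x in Set.Ioo (-1:ℝ) 1, ∫ y in Set.Ioo (-1:ℝ) 1, sincKernel c x y * f y * f x

/-- The `(n+1)`-st eigenvalue `λ_n(c)` of `Q_c`, via the Courant–Fischer min-max principle. -/
noncomputable def lambda (n : ℕ) (c : ℝ) : ℝ :=
  ⨆ V : {V : Submodule ℝ (Lp ℝ 2 (volume.restrict (Set.Ioo (-1:ℝ) 1))) //
          Module.finrank ℝ V = n + 1},
    ⨅ f : {f : Lp ℝ 2 (volume.restrict (Set.Ioo (-1:ℝ) 1)) // f ∈ V.1 ∧ f ≠ 0},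
      QForm c (f.1 : ℝ → ℝ) / ‖f.1‖^2

/-- The Fourier transform of `f` restricted to `(-1, 1)`. -/
noncomputable def fourierAt (f : ℝ → ℝ) (s : ℝ) : ℂ :=
  ∫ x in Set.Ioo (-1:ℝ) 1, (f x : ℂ) * Complex.exp (((s * x : ℝ) : ℂ) * Complex.I)

lemma integrable_mul_exp {f : ℝ → ℝ} (hf : IntegrableOn f (Set.Ioo (-1:ℝ) 1)) (s : ℝ) :
    IntegrableOn (fun x => (f x : ℂ) * Complex.exp (((s * x : ℝ) : ℂ) * Complex.I))
      (Set.Ioo (-1:ℝ) 1) := by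
  refine Integrable.mul_bdd (c := 1) hf.ofReal (by fun_prop) ?_
  filter_upwards with x
  rw [Complex.norm_exp_ofReal_mul_I]

lemma norm_fourierAt_le {f : ℝ → ℝ} (s : ℝ) :
    ‖fourierAt f s‖ ≤ ∫ x in Set.Ioo (-1:ℝ) 1, |f x| := by
  refine (norm_integral_le_integral_norm _).trans (le_of_eq ?_)
  refine integral_congr_ae ?_
  filter_upwards with x
  rw [norm_mul, Complex.norm_exp_ofReal_mul_I, Complex.norm_real, mul_one, Real.norm_eq_abs]

lemma norm_sq_fourierAt {f : ℝ → ℝ} (hf : IntegrableOn f (Set.Ioo (-1:ℝ) 1)) (s : ℝ) :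
    ‖fourierAt f s‖ ^ 2 = ∫ z, Real.cos (s * (z.1 - z.2)) * (f z.2 * f z.1)
      ∂((volume.restrict (Set.Ioo (-1:ℝ) 1)).prod (volume.restrict (Set.Ioo (-1:ℝ) 1))) := by
  have hc : IntegrableOn (fun x => f x * Real.cos (s * x)) (Set.Ioo (-1:ℝ) 1) := by
    refine Integrable.mul_bdd (c := 1) hf (by fun_prop) ?_
    filter_upwards with x using Real.abs_cos_le_one _
  have hs : IntegrableOn (fun x => f x * Real.sin (s * x)) (Set.Ioo (-1:ℝ) 1) := by
    refine Integrable.mul_bdd (c := 1) hf (by fun_prop) ?_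
    filter_upwards with x using Real.abs_sin_le_one _
  have hre : (fourierAt f s).re = ∫ x in Set.Ioo (-1:ℝ) 1, f x * Real.cos (s * x) := by
    unfold fourierAt
    rw [← RCLike.re_eq_complex_re, ← integral_re (integrable_mul_exp hf s)]
    congr with x
    rw [RCLike.re_eq_complex_re, Complex.re_ofReal_mul, Complex.exp_ofReal_mul_I_re]
  have him : (fourierAt f s).im = ∫ x in Set.Ioo (-1:ℝ) 1, f x * Real.sin (s * x) := by
    unfold fourierAt
    rw [← RCLike.im_eq_complex_im, ← integral_im (integrable_mul_exp hf s)]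
    congr with x
    rw [RCLike.im_eq_complex_im, Complex.im_ofReal_mul, Complex.exp_ofReal_mul_I_im]
  rw [← Complex.normSq_eq_norm_sq, Complex.normSq_apply, hre, him, ← integral_prod_mul,
    ← integral_prod_mul, ← integral_add (hc.mul_prod hc) (hs.mul_prod hs)]
  congr with z
  rw [mul_sub, Real.cos_sub]
  ring

lemma sincKernel_eq (c x y : ℝ) :
    sincKernel c x y = (1 / (2 * Real.pi)) * ∫ s in (-c)..c, Real.cos (s * (x - y)) := by
  unfold sincKernel
  split_ifs with h
  · subst h
    simp
    field_simp
    ring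
  · have : x - y ≠ 0 := sub_ne_zero.mpr h
    rw [intervalIntegral.integral_comp_mul_right _ this, integral_cos, neg_mul, Real.sin_neg,
      smul_eq_mul]
    field_simp
    ring

/-- `Q_c` is, up to a constant, the square of the Fourier transform restricted to `[-c, c]`. -/
lemma QForm_eq {f : ℝ → ℝ} (hf : IntegrableOn f (Set.Ioo (-1:ℝ) 1)) {c : ℝ} (hc : 0 ≤ c) :
    QForm c f = (1 / (2 * Real.pi)) * ∫ s in (-c)..c, ‖fourierAt f s‖ ^ 2 := by
  set μ := (volume : Measure ℝ).restrict (Set.Ioo (-1:ℝ) 1) with hμ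
  set ν := (volume : Measure ℝ).restrict (Set.Ioc (-c) c) with hν
  have hf' : Integrable f μ := hf
  have hprod : Integrable (fun z : ℝ × ℝ => f z.2 * f z.1) (μ.prod μ) := by
    simpa only [mul_comm] using hf'.mul_prod hf'
  have hG : Integrable (fun p : ℝ × (ℝ × ℝ) =>
      Real.cos (p.1 * (p.2.1 - p.2.2)) * (f p.2.2 * f p.2.1)) (ν.prod (μ.prod μ)) := by
    refine Integrable.bdd_mul (c := 1) ?_ (by fun_prop) ?_
    · simpa using (integrable_const (1:ℝ) : Integrable _ ν).mul_prod hprod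
    · filter_upwards with x using Real.abs_cos_le_one _
  have h1 : ∫ s in (-c)..c, ‖fourierAt f s‖ ^ 2 =
      ∫ z, ∫ s, Real.cos (s * (z.1 - z.2)) * (f z.2 * f z.1) ∂ν ∂(μ.prod μ) := by
    rw [intervalIntegral.integral_of_le (by linarith), ← integral_integral_swap hG]
    simp_rw [norm_sq_fourierAt hf]
    rfl
  have hG2 : Integrable (fun z : ℝ × ℝ =>
      ∫ s, Real.cos (s * (z.1 - z.2)) * (f z.2 * f z.1) ∂ν) (μ.prod μ) :=
    hG.integral_prod_right
  rw [h1, integral_prod _ hG2, ← integral_const_mul]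
  unfold QForm
  congr with x
  rw [← integral_const_mul]
  congr with y
  rw [integral_mul_const, sincKernel_eq, intervalIntegral.integral_of_le (by linarith)]
  ring

lemma integrableOn_of_Lp (f : Lp ℝ 2 (volume.restrict (Set.Ioo (-1:ℝ) 1))) :
    IntegrableOn f (Set.Ioo (-1:ℝ) 1) :=
  (Lp.memLp f).integrable (by norm_num)

lemma Lp_norm_sq_eq (f : Lp ℝ 2 (volume.restrict (Set.Ioo (-1:ℝ) 1))) :
    ‖f‖ ^ 2 = ∫ x in Set.Ioo (-1:ℝ) 1, f x ^ 2 := by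
  rw [← real_inner_self_eq_norm_sq, L2.inner_def]
  congr with x
  simp [sq]

lemma sq_integral_abs_le (f : Lp ℝ 2 (volume.restrict (Set.Ioo (-1:ℝ) 1))) :
    (∫ x in Set.Ioo (-1:ℝ) 1, |f x|) ^ 2 ≤ 2 * ‖f‖ ^ 2 := by
  have h1 : IntegrableOn (fun x => f x ^ 2) (Set.Ioo (-1:ℝ) 1) := (Lp.memLp f).integrable_sq
  have h2 : IntegrableOn (fun x => |f x|) (Set.Ioo (-1:ℝ) 1) := (integrableOn_of_Lp f).abs
  set m := ∫ x in Set.Ioo (-1:ℝ) 1, |f x| with hm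
  have h3 : 0 ≤ ∫ x in Set.Ioo (-1:ℝ) 1, (f x ^ 2 - m * |f x| + (m / 2) ^ 2) := by
    refine integral_nonneg fun x => ?_
    have := sq_nonneg (|f x| - m / 2)
    have h4 := sq_abs (f x)
    dsimp only [Pi.zero_apply]
    nlinarith
  have h5 : ∫ x in Set.Ioo (-1:ℝ) 1, (f x ^ 2 - m * |f x| + (m / 2) ^ 2) =
      (∫ x in Set.Ioo (-1:ℝ) 1, (f x ^ 2 - m * |f x|)) + ∫ x in Set.Ioo (-1:ℝ) 1, (m / 2) ^ 2 :=
    integral_add (h1.sub (h2.const_mul m)) (by simp)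
  rw [h5, integral_sub h1 (h2.const_mul m), integral_const_mul, ← hm, ← Lp_norm_sq_eq] at h3
  simp at h3
  norm_num at h3
  nlinarith

lemma QForm_nonneg {c : ℝ} (hc : 0 ≤ c) (f : Lp ℝ 2 (volume.restrict (Set.Ioo (-1:ℝ) 1))) :
    0 ≤ QForm c f := by
  rw [QForm_eq (integrableOn_of_Lp f) hc]
  have : 0 ≤ ∫ s in (-c)..c, ‖fourierAt f s‖ ^ 2 :=
    intervalIntegral.integral_nonneg (by linarith) fun s _ => by positivity
  positivity

lemma QForm_le_of_fourierAt_le {c K : ℝ} (hc : 0 ≤ c)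
    (f : Lp ℝ 2 (volume.restrict (Set.Ioo (-1:ℝ) 1)))
    (hK : ∀ s ∈ Set.Icc (-c) c, s ≠ 0 → ‖fourierAt f s‖ ^ 2 ≤ K) :
    QForm c f ≤ c * K := by
  have hK0 : 0 ≤ c * K := by
    rcases hc.eq_or_lt with rfl | h
    · simp
    · have := (sq_nonneg _).trans (hK c ⟨by linarith, le_rfl⟩ h.ne')
      positivity
  have h1 : ∫ s in (-c)..c, ‖fourierAt f s‖ ^ 2 ≤ K * |c - (-c)| := by
    refine (Real.le_norm_self _).trans (intervalIntegral.norm_integral_le_of_norm_le_const_ae ?_)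
    filter_upwards [Measure.ae_ne volume (0:ℝ)] with s hs hsc
    rw [Set.uIoc_of_le (by linarith)] at hsc
    simpa using hK s ⟨hsc.1.le, hsc.2⟩ hs
  rw [abs_of_nonneg (by linarith)] at h1
  have hpi := Real.two_le_pi
  rw [QForm_eq (integrableOn_of_Lp f) hc, one_div, inv_mul_le_iff₀ (by positivity)]
  nlinarith

lemma QForm_le {c : ℝ} (hc : 0 ≤ c) (f : Lp ℝ 2 (volume.restrict (Set.Ioo (-1:ℝ) 1))) :
    QForm c f ≤ c * (2 * ‖f‖ ^ 2) := by
  refine QForm_le_of_fourierAt_le hc f fun s _ _ => le_trans ?_ (sq_integral_abs_le f)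
  gcongr
  exact norm_fourierAt_le s

lemma lambda_le_of_forall {n : ℕ} {c B : ℝ} (hc : 0 ≤ c) (hB : 0 ≤ B)
    (h : ∀ V : Submodule ℝ (Lp ℝ 2 (volume.restrict (Set.Ioo (-1:ℝ) 1))),
      Module.finrank ℝ V = n + 1 → ∃ f ∈ V, f ≠ 0 ∧ QForm c f ≤ B * ‖f‖ ^ 2) :
    lambda n c ≤ B := by
  unfold lambda
  refine Real.iSup_le (fun V => ?_) hB
  obtain ⟨f, hfV, hf0, hf⟩ := h V.1 V.2
  have hpos : 0 < ‖f‖ ^ 2 := by positivity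
  refine (ciInf_le ?_ (⟨f, hfV, hf0⟩ : {f // f ∈ V.1 ∧ f ≠ 0})).trans ?_
  · refine ⟨0, ?_⟩
    rintro _ ⟨g, rfl⟩
    exact div_nonneg (QForm_nonneg hc _) (by positivity)
  · exact (div_le_iff₀ hpos).mpr hf

lemma le_lambda_of_exists {n : ℕ} {c B : ℝ} (hc : 0 ≤ c)
    (V : Submodule ℝ (Lp ℝ 2 (volume.restrict (Set.Ioo (-1:ℝ) 1))))
    (hV : Module.finrank ℝ V = n + 1) (h : ∀ f ∈ V, B * ‖f‖ ^ 2 ≤ QForm c f) :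
    B ≤ lambda n c := by
  have hne : ∀ W : {W : Submodule ℝ (Lp ℝ 2 (volume.restrict (Set.Ioo (-1:ℝ) 1))) //
      Module.finrank ℝ W = n + 1}, Nonempty {f // f ∈ W.1 ∧ f ≠ 0} := by
    rintro ⟨W, hW⟩
    have : W ≠ ⊥ := by
      rintro rfl
      simp at hW
    obtain ⟨f, hf, hf0⟩ := W.exists_mem_ne_zero_of_ne_bot this
    exact ⟨⟨f, hf, hf0⟩⟩
  have hbdd : BddAbove (Set.range fun W : {W : Submodule ℝ
      (Lp ℝ 2 (volume.restrict (Set.Ioo (-1:ℝ) 1))) // Module.finrank ℝ W = n + 1} =>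
      ⨅ f : {f : Lp ℝ 2 (volume.restrict (Set.Ioo (-1:ℝ) 1)) // f ∈ W.1 ∧ f ≠ 0},
        QForm c (f.1 : ℝ → ℝ) / ‖f.1‖^2) := by
    refine ⟨c * 2, ?_⟩
    rintro _ ⟨W, rfl⟩
    obtain ⟨f⟩ := hne W
    have hpos : 0 < ‖f.1‖ ^ 2 := by have := norm_pos_iff.mpr f.2.2; positivity
    refine (ciInf_le ?_ f).trans ?_
    · refine ⟨0, ?_⟩
      rintro _ ⟨g, rfl⟩
      exact div_nonneg (QForm_nonneg hc _) (by positivity)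
    · rw [div_le_iff₀ hpos, mul_assoc]
      exact QForm_le hc _
  refine le_trans ?_ (le_ciSup hbdd ⟨V, hV⟩)
  have := hne ⟨V, hV⟩
  refine le_ciInf fun f => ?_
  have hpos : 0 < ‖f.1‖ ^ 2 := by have := norm_pos_iff.mpr f.2.2; positivity
  exact (le_div_iff₀ hpos).mpr (h _ f.2.1)

lemma integral_zero_pi_cos_int_mul {m : ℤ} (hm : m ≠ 0) :
    ∫ θ in (0:ℝ)..Real.pi, Real.cos (m * θ) = 0 := by
  have hm' : (m:ℝ) ≠ 0 := by exact_mod_cast hm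
  rw [intervalIntegral.integral_comp_mul_left _ hm']
  simp [Real.sin_int_mul_pi]

lemma integral_zero_pi_sin_mul_sin (j k : ℕ) :
    ∫ θ in (0:ℝ)..Real.pi, Real.sin ((j + 1) * θ) * Real.sin ((k + 1) * θ) =
      if j = k then Real.pi / 2 else 0 := by
  have h (θ : ℝ) : Real.sin ((j + 1) * θ) * Real.sin ((k + 1) * θ) =
      (1 / 2) * (Real.cos (((j - k : ℤ) : ℝ) * θ) - Real.cos (((j + k + 2 : ℤ) : ℝ) * θ)) := by
    have h1 : (((j - k : ℤ) : ℝ) * θ) = (j + 1) * θ - (k + 1) * θ := by push_cast; ring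
    have h2 : (((j + k + 2 : ℤ) : ℝ) * θ) = (j + 1) * θ + (k + 1) * θ := by push_cast; ring
    rw [h1, h2, Real.cos_sub, Real.cos_add]
    ring
  simp_rw [h]
  rw [intervalIntegral.integral_const_mul, intervalIntegral.integral_sub
    (Continuous.intervalIntegrable (by fun_prop) _ _)
    (Continuous.intervalIntegrable (by fun_prop) _ _),
    integral_zero_pi_cos_int_mul (m := j + k + 2) (by omega)]
  split_ifs with hjk
  · subst hjk
    simp
    ring
  · rw [integral_zero_pi_cos_int_mul (by omega)]
    simp

open Polynomial in
/-- Parseval's lower bound for the Chebyshev expansion of the second kind. -/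
lemma sum_sq_le_integral_sum_U (s : Finset ℕ) (β : ℕ → ℝ) :
    Real.pi / 2 * ∑ k ∈ s, β k ^ 2 ≤
      ∫ x in (-1:ℝ)..1, (∑ k ∈ s, β k * (Chebyshev.U ℝ k).eval x) ^ 2 := by
  set g : ℝ → ℝ := fun x => ∑ k ∈ s, β k * (Chebyshev.U ℝ k).eval x with hg
  have hgc : Continuous g := by fun_prop
  have h1 : ∫ x, (g x ^ 2 * (1 - x ^ 2)) ∂Chebyshev.measureT = Real.pi / 2 * ∑ k ∈ s, β k ^ 2 := by
    rw [Chebyshev.integral_measureT_eq_integral_cos]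
    have h (θ : ℝ) : g (Real.cos θ) ^ 2 * (1 - Real.cos θ ^ 2) = ∑ j ∈ s, ∑ k ∈ s,
        β j * β k * (Real.sin ((j + 1) * θ) * Real.sin ((k + 1) * θ)) := by
      rw [← Real.sin_sq, ← mul_pow, hg, Finset.sum_mul, sq, Finset.sum_mul_sum]
      refine Finset.sum_congr rfl fun j _ => Finset.sum_congr rfl fun k _ => ?_
      have e1 := Chebyshev.U_real_cos θ j
      have e2 := Chebyshev.U_real_cos θ k
      push_cast at e1 e2
      rw [← e1, ← e2]
      ring
    simp_rw [h]
    rw [intervalIntegral.integral_finsetSum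
      fun j _ => Continuous.intervalIntegrable (by fun_prop) _ _, Finset.mul_sum]
    refine Finset.sum_congr rfl fun j hj => ?_
    rw [intervalIntegral.integral_finsetSum
      fun j _ => Continuous.intervalIntegrable (by fun_prop) _ _]
    simp_rw [intervalIntegral.integral_const_mul, integral_zero_pi_sin_mul_sin]
    simp [hj]
    ring
  rw [← h1, Chebyshev.integral_measureT]
  refine intervalIntegral.integral_mono_on (by norm_num) ?_
    (Continuous.intervalIntegrable (by fun_prop) _ _) fun x hx => ?_
  · exact Chebyshev.intervalIntegrable_sqrt_one_sub_sq_inv.continuousOn_mul (by fun_prop)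
  · have hx0 : 0 ≤ 1 - x ^ 2 := by nlinarith [hx.1, hx.2]
    have h2 : (1 - x ^ 2) * √(1 - x ^ 2)⁻¹ ≤ 1 := by
      rw [Real.sqrt_inv, ← div_eq_mul_inv, Real.div_sqrt]
      exact Real.sqrt_le_one.mpr (by nlinarith [sq_nonneg x])
    rw [mul_assoc]
    exact mul_le_of_le_one_right (sq_nonneg _) h2

open Polynomial in
lemma sum_sq_le_integral_norm_sq_sum_U (n : ℕ) (α : ℕ → ℝ) :
    Real.pi / 2 * ∑ k ∈ Finset.range n, α k ^ 2 ≤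
      ∫ x in (-1:ℝ)..1, ‖∑ k ∈ Finset.range n,
        ((α k : ℂ) * (-Complex.I) ^ k) * (((Chebyshev.U ℝ k).eval x : ℝ) : ℂ)‖ ^ 2 := by
  have h1 := sum_sq_le_integral_sum_U (Finset.range n) fun k => α k * ((-Complex.I) ^ k).re
  have h2 := sum_sq_le_integral_sum_U (Finset.range n) fun k => α k * ((-Complex.I) ^ k).im
  have h3 : ∀ x : ℝ, ‖∑ k ∈ Finset.range n,
        ((α k : ℂ) * (-Complex.I) ^ k) * (((Chebyshev.U ℝ k).eval x : ℝ) : ℂ)‖ ^ 2 =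
      (∑ k ∈ Finset.range n, α k * ((-Complex.I) ^ k).re * (Chebyshev.U ℝ k).eval x) ^ 2 +
      (∑ k ∈ Finset.range n, α k * ((-Complex.I) ^ k).im * (Chebyshev.U ℝ k).eval x) ^ 2 := by
    intro x
    rw [← Complex.normSq_eq_norm_sq, Complex.normSq_apply, Complex.re_sum, Complex.im_sum]
    simp_rw [Complex.re_mul_ofReal, Complex.im_mul_ofReal, Complex.re_ofReal_mul,
      Complex.im_ofReal_mul]
    ring
  simp_rw [h3]
  rw [intervalIntegral.integral_add (Continuous.intervalIntegrable (by fun_prop) _ _)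
    (Continuous.intervalIntegrable (by fun_prop) _ _)]
  refine le_trans (le_of_eq ?_) (add_le_add h1 h2)
  rw [← mul_add, ← Finset.sum_add_distrib]
  congr 1
  refine Finset.sum_congr rfl fun k _ => ?_
  have : ((-Complex.I) ^ k).re ^ 2 + ((-Complex.I) ^ k).im ^ 2 = 1 := by
    have h : ‖(-Complex.I) ^ k‖ ^ 2 = 1 := by simp
    rwa [← Complex.normSq_eq_norm_sq, Complex.normSq_apply, ← sq, ← sq] at h
  linear_combination (-(α k ^ 2)) * this

lemma fourierAt_eq_intervalIntegral (f : ℝ → ℝ) (s : ℝ) :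
    fourierAt f s = ∫ x in (-1:ℝ)..1, (f x : ℂ) * Complex.exp (((s * x : ℝ) : ℂ) * Complex.I) := by
  rw [intervalIntegral.integral_of_le (by norm_num), integral_Ioc_eq_integral_Ioo]
  rfl

lemma hasDerivAt_exp_ofReal_mul_I (s x : ℝ) :
    HasDerivAt (fun y : ℝ => Complex.exp (((s * y : ℝ) : ℂ) * Complex.I))
      (Complex.exp (((s * x : ℝ) : ℂ) * Complex.I) * (s * Complex.I)) x := by
  have h : HasDerivAt (fun y : ℝ => ((s * y : ℝ) : ℂ) * Complex.I) (s * Complex.I) x := by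
    have := (((hasDerivAt_id x).const_mul s).ofReal_comp).mul_const Complex.I
    simpa using this
  exact h.cexp

lemma fourierAt_add {f g : ℝ → ℝ} (hf : IntegrableOn f (Set.Ioo (-1:ℝ) 1))
    (hg : IntegrableOn g (Set.Ioo (-1:ℝ) 1)) (s : ℝ) :
    fourierAt (fun x => f x + g x) s = fourierAt f s + fourierAt g s := by
  unfold fourierAt
  rw [← integral_add (integrable_mul_exp hf s) (integrable_mul_exp hg s)]
  simp [add_mul]

lemma fourierAt_const_mul (r : ℝ) (f : ℝ → ℝ) (s : ℝ) :
    fourierAt (fun x => r * f x) s = r * fourierAt f s := by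
  unfold fourierAt
  rw [← integral_const_mul]
  simp [mul_assoc]

section Polynomials

open Polynomial

lemma integrableOn_polynomial (p : ℝ[X]) :
    IntegrableOn (fun x => p.eval x) (Set.Ioo (-1:ℝ) 1) :=
  (p.continuous.integrableOn_Icc).mono_set Set.Ioo_subset_Icc_self

lemma fourierAt_derivative {p : ℝ[X]} (h1 : p.eval 1 = 0) (h2 : p.eval (-1) = 0) (s : ℝ) :
    fourierAt (fun x => (derivative p).eval x) s =
      -Complex.I * s * fourierAt (fun x => p.eval x) s := by
  rw [fourierAt_eq_intervalIntegral, fourierAt_eq_intervalIntegral]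
  have key := intervalIntegral.integral_deriv_mul_eq_sub
    (a := (-1:ℝ)) (b := 1) (fun x _ => (p.hasDerivAt x).ofReal_comp)
    (fun x _ => hasDerivAt_exp_ofReal_mul_I s x)
    (Continuous.intervalIntegrable (by fun_prop) _ _)
    (Continuous.intervalIntegrable (by fun_prop) _ _)
  rw [intervalIntegral.integral_add (Continuous.intervalIntegrable (by fun_prop) _ _)
    (Continuous.intervalIntegrable (by fun_prop) _ _), h1, h2] at key
  simp_rw [← mul_assoc _ (Complex.exp _), ← mul_assoc] at key
  rw [intervalIntegral.integral_mul_const, intervalIntegral.integral_mul_const] at key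
  rw [Complex.ofReal_zero] at key
  linear_combination key

lemma pow_dvd_derivative {q p : ℝ[X]} {m : ℕ} (h : q ^ (m + 1) ∣ p) : q ^ m ∣ derivative p := by
  obtain ⟨r, rfl⟩ := h
  refine ⟨C ((m:ℝ) + 1) * derivative q * r + q * derivative r, ?_⟩
  rw [derivative_mul, derivative_pow]
  push_cast
  simp
  ring

/-- The derivative combination of `(1 - X ^ 2) ^ n` whose Fourier transform is the Chebyshev
polynomial `U_k (s / c)` times that of `(1 - X ^ 2) ^ n`, up to a power of `-i`. -/
noncomputable def testPoly (n : ℕ) (c : ℝ) : ℕ → ℝ[X]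
  | 0 => (1 - X ^ 2) ^ n
  | 1 => C (2 / c) * derivative ((1 - X ^ 2) ^ n)
  | k + 2 => C (2 / c) * derivative (testPoly n c (k + 1)) + testPoly n c k

lemma pow_dvd_testPoly (n : ℕ) (c : ℝ) :
    ∀ k m : ℕ, m + k ≤ n → ((1 - X ^ 2 : ℝ[X])) ^ m ∣ testPoly n c k
  | 0, m, h => pow_dvd_pow _ (by omega)
  | 1, m, h => Dvd.dvd.mul_left (pow_dvd_derivative (pow_dvd_pow _ (by omega))) _
  | k + 2, m, h => dvd_add
      (Dvd.dvd.mul_left (pow_dvd_derivative (pow_dvd_testPoly n c (k + 1) (m + 1) (by omega))) _)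
      (pow_dvd_testPoly n c k m (by omega))

lemma eval_eq_zero_of_dvd {p : ℝ[X]} (h : (1 - X ^ 2 : ℝ[X]) ∣ p) :
    p.eval 1 = 0 ∧ p.eval (-1) = 0 := by
  obtain ⟨r, rfl⟩ := h
  simp

lemma fourierAt_testPoly {n : ℕ} {c : ℝ} (s : ℝ) :
    ∀ k : ℕ, k ≤ n → fourierAt (fun x => (testPoly n c k).eval x) s =
      (-Complex.I) ^ k * (((Chebyshev.U ℝ k).eval (s / c) : ℝ) : ℂ) *
        fourierAt (fun x => ((1 - X ^ 2 : ℝ[X]) ^ n).eval x) s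
  | 0, h => by simp [testPoly]
  | 1, h => by
    obtain ⟨h1, h2⟩ := eval_eq_zero_of_dvd (dvd_pow_self (1 - X ^ 2 : ℝ[X]) (n := n) (by omega))
    simp only [testPoly, eval_mul, eval_C]
    rw [fourierAt_const_mul, fourierAt_derivative h1 h2]
    simp
    ring
  | k + 2, h => by
    have hd := pow_dvd_testPoly n c (k + 1) 1 (by omega)
    rw [pow_one] at hd
    obtain ⟨h1, h2⟩ := eval_eq_zero_of_dvd hd
    simp only [testPoly, eval_mul, eval_C, eval_add]
    rw [fourierAt_add ((integrableOn_polynomial _).const_mul _) (integrableOn_polynomial _),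
      fourierAt_const_mul, fourierAt_derivative h1 h2, fourierAt_testPoly s (k + 1) (by omega),
      fourierAt_testPoly s k (by omega)]
    have hU : (Chebyshev.U ℝ ((k + 2 : ℕ) : ℤ)).eval (s / c) =
        2 * (s / c) * (Chebyshev.U ℝ ((k + 1 : ℕ) : ℤ)).eval (s / c) -
          (Chebyshev.U ℝ (k : ℤ)).eval (s / c) := by
      push_cast
      rw [Chebyshev.U_add_two]
      simp
    rw [hU]
    generalize (Chebyshev.U ℝ ((k + 1 : ℕ) : ℤ)).eval (s / c) = u
    generalize (Chebyshev.U ℝ (k : ℤ)).eval (s / c) = v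
    push_cast
    generalize fourierAt (fun x => ((1 - X ^ 2 : ℝ[X]) ^ n).eval x) s = h
    linear_combination ((-Complex.I) ^ k * v * h) * Complex.I_sq

lemma integral_mul_cos_eq_re_fourierAt {f : ℝ → ℝ} (hf : Continuous f) (s : ℝ) :
    (fourierAt f s).re = ∫ x in (-1:ℝ)..1, f x * Real.cos (s * x) := by
  rw [fourierAt_eq_intervalIntegral, ← Complex.reCLM_apply, ← Complex.reCLM.intervalIntegral_comp_comm
    (Continuous.intervalIntegrable (by fun_prop) _ _)]
  refine intervalIntegral.integral_congr fun x _ => ?_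
  rw [Complex.reCLM_apply, Complex.re_ofReal_mul, Complex.exp_ofReal_mul_I_re]

/-- The cosine transform of `(1 - x ^ 2) ^ n`. -/
noncomputable def cosMoment (n : ℕ) (s : ℝ) : ℝ :=
  (fourierAt (fun x => ((1 - X ^ 2 : ℝ[X]) ^ n).eval x) s).re

lemma cosMoment_eq (n : ℕ) (s : ℝ) :
    cosMoment n s = ∫ x in (-1:ℝ)..1, (1 - x ^ 2) ^ n * Real.cos (s * x) := by
  rw [cosMoment, integral_mul_cos_eq_re_fourierAt (by fun_prop)]
  simp

lemma cosMoment_rec (n : ℕ) (s : ℝ) :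
    s ^ 2 * cosMoment (n + 2) s =
      2 * (n + 2) * (2 * n + 3) * cosMoment (n + 1) s - 4 * (n + 2) * (n + 1) * cosMoment n s := by
  set w : ℝ[X] := 1 - X ^ 2 with hw
  have hd : derivative (derivative (w ^ (n + 2))) =
      C (4 * ((n:ℝ) + 2) * (n + 1)) * w ^ n + C (-(2 * ((n:ℝ) + 2) * (2 * n + 3))) * w ^ (n + 1) := by
    have hw' : derivative w = -(2 * X) := by simp [hw]; norm_num
    rw [derivative_pow, hw']
    simp only [derivative_C, derivative_mul, derivative_neg, derivative_pow, hw', derivative_X, derivative_ofNat,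
      Nat.add_sub_cancel, show n + 2 - 1 = n + 1 by omega]
    have hX : (X:ℝ[X]) ^ 2 = 1 - w := by rw [hw]; ring
    simp only [map_mul, map_add, map_neg, map_ofNat, map_natCast, map_one]
    push_cast
    linear_combination (4 * ((n:ℝ[X]) + 2) * (n + 1) * w ^ n) * hX
  have h1 : (w ^ (n + 2)).eval 1 = 0 ∧ (w ^ (n + 2)).eval (-1) = 0 :=
    eval_eq_zero_of_dvd (dvd_pow_self _ (by omega))
  have h2 : (derivative (w ^ (n + 2))).eval 1 = 0 ∧ (derivative (w ^ (n + 2))).eval (-1) = 0 := by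
    refine eval_eq_zero_of_dvd ?_
    have := pow_dvd_derivative (q := w) (m := 1) (pow_dvd_pow w (show 1 + 1 ≤ n + 2 by omega))
    rwa [pow_one] at this
  have h3 := fourierAt_derivative h2.1 h2.2 s
  rw [fourierAt_derivative h1.1 h1.2, hd] at h3
  simp only [eval_add, eval_mul, eval_C] at h3
  rw [fourierAt_add ((integrableOn_polynomial _).const_mul _)
    ((integrableOn_polynomial _).const_mul _), fourierAt_const_mul, fourierAt_const_mul] at h3
  have h4 : -Complex.I * s * (-Complex.I * s * fourierAt (fun x => (w ^ (n + 2)).eval x) s) =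
      ((-(s ^ 2) : ℝ) : ℂ) * fourierAt (fun x => (w ^ (n + 2)).eval x) s := by
    push_cast
    linear_combination ((s:ℂ) ^ 2 * fourierAt (fun x => (w ^ (n + 2)).eval x) s) * Complex.I_sq
  rw [h4] at h3
  have h5 := congrArg Complex.re h3
  simp only [Complex.add_re, Complex.re_ofReal_mul] at h5
  simp only [cosMoment, ← hw]
  linear_combination h5

lemma cosMoment_zero_zero : cosMoment 0 0 = 2 := by
  rw [cosMoment_eq]; norm_num

lemma cosMoment_succ_zero (n : ℕ) :
    (2 * n + 3) * cosMoment (n + 1) 0 = (2 * n + 2) * cosMoment n 0 := by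
  have h := cosMoment_rec n 0
  have h2 : ((n:ℝ) + 2) ≠ 0 := by positivity
  refine mul_left_cancel₀ h2 ?_
  linear_combination (-1/2) * h

lemma two_div_le_cosMoment_zero (n : ℕ) : 2 / ((n:ℝ) + 1) ≤ cosMoment n 0 := by
  induction n with
  | zero => rw [cosMoment_zero_zero]; norm_num
  | succ n ih =>
    have h := cosMoment_succ_zero n
    rw [div_le_iff₀ (by positivity)] at ih ⊢
    push_cast
    nlinarith

lemma abs_cosMoment_le (n : ℕ) (s : ℝ) : |cosMoment n s| ≤ cosMoment n 0 := by
  rw [cosMoment_eq, cosMoment_eq, ← Real.norm_eq_abs]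
  refine intervalIntegral.norm_integral_le_of_norm_le (by norm_num) ?_
    (Continuous.intervalIntegrable (by fun_prop) _ _)
  refine Filter.Eventually.of_forall fun x hx => ?_
  have hx0 : 0 ≤ 1 - x ^ 2 := by nlinarith [hx.1, hx.2]
  have := pow_nonneg hx0 n
  rw [norm_mul, Real.norm_eq_abs, Real.norm_eq_abs, abs_of_nonneg this]
  simp only [zero_mul, Real.cos_zero]
  gcongr
  exact Real.abs_cos_le_one _

lemma cosMoment_ge (n : ℕ) (s : ℝ) :
    cosMoment n 0 * (1 - s ^ 2 / (2 * (2 * n + 3))) ≤ cosMoment n s := by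
  have h1 : ∫ x in (-1:ℝ)..1, (1 - x ^ 2) ^ n * (1 - s ^ 2 / 2 + s ^ 2 / 2 * (1 - x ^ 2)) ≤
      cosMoment n s := by
    rw [cosMoment_eq]
    refine intervalIntegral.integral_mono_on (by norm_num)
      (Continuous.intervalIntegrable (by fun_prop) _ _)
      (Continuous.intervalIntegrable (by fun_prop) _ _) fun x hx => ?_
    have hx0 : 0 ≤ 1 - x ^ 2 := by nlinarith [hx.1, hx.2]
    have := Real.one_sub_sq_div_two_le_cos (x := s * x)
    gcongr
    nlinarith
  have h2 : ∫ x in (-1:ℝ)..1, (1 - x ^ 2) ^ n * (1 - s ^ 2 / 2 + s ^ 2 / 2 * (1 - x ^ 2)) =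
      (1 - s ^ 2 / 2) * cosMoment n 0 + s ^ 2 / 2 * cosMoment (n + 1) 0 := by
    rw [cosMoment_eq, cosMoment_eq, ← intervalIntegral.integral_const_mul,
      ← intervalIntegral.integral_const_mul, ← intervalIntegral.integral_add
      (Continuous.intervalIntegrable (by fun_prop) _ _)
      (Continuous.intervalIntegrable (by fun_prop) _ _)]
    refine intervalIntegral.integral_congr fun x _ => ?_
    simp
    ring
  have h3 := cosMoment_succ_zero n
  have h4 : cosMoment (n + 1) 0 = (2 * n + 2) * cosMoment n 0 / (2 * n + 3) := by
    field_simp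
    linear_combination h3
  rw [h2, h4] at h1
  refine le_trans (le_of_eq ?_) h1
  field_simp
  ring

lemma one_sub_ge_exp {y : ℝ} (h0 : 0 ≤ y) (h1 : y ≤ 1 / 2) : Real.exp (-(2 * y)) ≤ 1 - y := by
  rw [Real.exp_neg]
  have h2 : 1 + 2 * y ≤ Real.exp (2 * y) := by linarith [Real.add_one_le_exp (2 * y)]
  refine (inv_anti₀ (by positivity) h2).trans ?_
  rw [inv_le_iff_one_le_mul₀ (by positivity)]
  nlinarith

lemma lower_bound_of_backward_rec {J : ℕ → ℝ} {s : ℝ} {n N : ℕ} (hs : s ^ 2 ≤ ((n:ℝ) + 1) ^ 2)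
    (hrec : ∀ k, J k = J (k + 1) - s ^ 2 / ((2 * k + 3) * (2 * k + 5)) * J (k + 2))
    (hN : 1 / 2 ≤ J N) (hN' : J (N + 1) ≤ 1) :
    ∀ d k : ℕ, n ≤ k → k + d = N →
      1 / 2 * Real.exp (-(2 * s ^ 2 / (2 * k + 3))) ≤ J k ∧ J (k + 1) ≤ 2 * J k
  | 0, k, hk, hd => by
    obtain rfl : k = N := by omega
    refine ⟨?_, by linarith⟩
    have : Real.exp (-(2 * s ^ 2 / (2 * k + 3))) ≤ 1 := Real.exp_le_one_iff.mpr (by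
      have : 0 ≤ 2 * s ^ 2 / (2 * (k:ℝ) + 3) := by positivity
      linarith)
    linarith
  | d + 1, k, hk, hd => by
    obtain ⟨h1, h2⟩ := lower_bound_of_backward_rec hs hrec hN hN' d (k + 1) (by omega) (by omega)
    have hpos : 0 ≤ J (k + 1) := le_trans (by positivity) h1
    set y := 2 * s ^ 2 / ((2 * (k:ℝ) + 3) * (2 * k + 5)) with hy
    have hy0 : 0 ≤ y := by positivity
    have hkn : (n:ℝ) ≤ k := by exact_mod_cast hk
    have hy1 : y ≤ 1 / 2 := by
      rw [hy, div_le_iff₀ (by positivity)]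
      nlinarith [(Nat.cast_nonneg n : (0:ℝ) ≤ n)]
    have h3 : J (k + 1) * (1 - y) ≤ J k := by
      rw [hrec k]
      have : s ^ 2 / ((2 * (k:ℝ) + 3) * (2 * k + 5)) = y / 2 := by rw [hy]; field_simp
      rw [this]
      nlinarith
    refine ⟨?_, by nlinarith⟩
    refine le_trans ?_ ((mul_le_mul h1 (one_sub_ge_exp hy0 hy1) (by positivity) hpos).trans h3)
    rw [mul_assoc, ← Real.exp_add]
    gcongr
    push_cast
    rw [hy]
    refine le_of_eq ?_
    field_simp
    ring

lemma le_norm_fourierAt_one_sub_sq_pow {n : ℕ} {c s : ℝ} (hn : 0 < n) (hcn : c ≤ n)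
    (hs : |s| ≤ c) :
    1 / ((n:ℝ) + 1) * Real.exp (-(c ^ 2 / n)) ≤
      ‖fourierAt (fun x => ((1 - X ^ 2 : ℝ[X]) ^ n).eval x) s‖ := by
  refine le_trans ?_ (Complex.re_le_norm _)
  change _ ≤ cosMoment n s
  have hc : 0 ≤ c := (abs_nonneg s).trans hs
  have hsc : s ^ 2 ≤ c ^ 2 := by rw [← sq_abs s]; gcongr
  have hn' : (0:ℝ) < n := by exact_mod_cast hn
  have hZ : ∀ k, 0 < cosMoment k 0 := fun k =>
    lt_of_lt_of_le (by positivity) (two_div_le_cosMoment_zero k)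
  obtain ⟨N', hN'⟩ := exists_nat_ge (s ^ 2)
  have key := lower_bound_of_backward_rec (J := fun k => cosMoment k s / cosMoment k 0) (s := s)
    (n := n) (N := n + N') (by nlinarith) ?_ ?_ ?_ N' n le_rfl rfl
  · have h1 := key.1
    rw [le_div_iff₀ (hZ n)] at h1
    refine le_trans ?_ h1
    have h2 : Real.exp (-(c ^ 2 / n)) ≤ Real.exp (-(2 * s ^ 2 / (2 * n + 3))) := by
      refine Real.exp_le_exp.mpr (neg_le_neg ?_)
      rw [div_le_div_iff₀ (by positivity) hn']
      nlinarith
    have h3 := two_div_le_cosMoment_zero n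
    have h4 : 1 / ((n:ℝ) + 1) = 1 / 2 * (2 / (n + 1)) := by ring
    calc _ = 1 / 2 * Real.exp (-(c ^ 2 / n)) * (2 / (n + 1)) := by rw [h4]; ring
      _ ≤ _ := by gcongr
  · intro k
    have h0 := cosMoment_rec k s
    have h1 := cosMoment_succ_zero k
    have h2 := cosMoment_succ_zero (k + 1)
    push_cast at h2
    have e1 : cosMoment (k + 1) 0 = (2 * k + 2) * cosMoment k 0 / (2 * k + 3) := by
      field_simp
      linear_combination h1
    have e2 : cosMoment (k + 2) 0 = (2 * k + 4) * (2 * k + 2) * cosMoment k 0 /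
        ((2 * k + 3) * (2 * k + 5)) := by
      rw [e1] at h2
      field_simp at h2 ⊢
      linear_combination h2
    have hz := (hZ k).ne'
    have e3 : s ^ 2 * cosMoment (k + 2) s = _ := h0
    have e4 : cosMoment k s = (2 * (k + 2) * (2 * k + 3) * cosMoment (k + 1) s -
        s ^ 2 * cosMoment (k + 2) s) / (4 * (k + 2) * (k + 1)) := by
      field_simp
      linear_combination h0
    rw [e1, e2, e4]
    field_simp
    ring
  · rw [le_div_iff₀ (hZ _), mul_comm]
    refine le_trans ?_ (cosMoment_ge _ s)
    gcongr
    · exact (hZ _).le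
    · have : s ^ 2 / (2 * (2 * ((n + N' : ℕ):ℝ) + 3)) ≤ 1 / 2 := by
        rw [div_le_iff₀ (by positivity)]
        push_cast
        nlinarith
      linarith
  · rw [div_le_one (hZ _)]
    exact (le_abs_self _).trans (abs_cosMoment_le _ _)

lemma memLp_polynomial (p : ℝ[X]) :
    MemLp (fun x => p.eval x) 2 (volume.restrict (Set.Ioo (-1:ℝ) 1)) := by
  obtain ⟨B, hB⟩ := isCompact_Icc.exists_bound_of_continuousOn (s := Set.Icc (-1:ℝ) 1)
    p.continuous.continuousOn
  refine MemLp.of_bound (by fun_prop) B ?_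
  filter_upwards [ae_restrict_mem measurableSet_Ioo] with x hx
    using hB x (Set.Ioo_subset_Icc_self hx)

/-- A polynomial as an element of `L²((-1, 1))`. -/
noncomputable def polyLp : ℝ[X] →ₗ[ℝ] Lp ℝ 2 (volume.restrict (Set.Ioo (-1:ℝ) 1)) where
  toFun p := (memLp_polynomial p).toLp _
  map_add' p q := by
    rw [← MemLp.toLp_add]
    exact MemLp.toLp_congr _ _ (Filter.Eventually.of_forall fun x => by simp)
  map_smul' r p := by
    rw [RingHom.id_apply, ← MemLp.toLp_const_smul]
    exact MemLp.toLp_congr _ _ (Filter.Eventually.of_forall fun x => by simp)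

lemma coeFn_polyLp (p : ℝ[X]) :
    polyLp p =ᵐ[volume.restrict (Set.Ioo (-1:ℝ) 1)] fun x => p.eval x :=
  (memLp_polynomial p).coeFn_toLp

lemma inner_polyLp (p q : ℝ[X]) :
    inner ℝ (polyLp p) (polyLp q) = ∫ x in (-1:ℝ)..1, p.eval x * q.eval x := by
  rw [L2.inner_def, intervalIntegral.integral_of_le (by norm_num), integral_Ioc_eq_integral_Ioo]
  refine integral_congr_ae ?_
  filter_upwards [coeFn_polyLp p, coeFn_polyLp q] with x hp hq
  rw [hp, hq]
  simp [mul_comm]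

lemma inner_polyLp_derivative {p : ℝ[X]} (h : (1 - X ^ 2 : ℝ[X]) ∣ p) (q : ℝ[X]) :
    inner ℝ (polyLp (derivative p)) (polyLp q) = -inner ℝ (polyLp p) (polyLp (derivative q)) := by
  obtain ⟨h1, h2⟩ := eval_eq_zero_of_dvd h
  rw [inner_polyLp, inner_polyLp]
  have key := intervalIntegral.integral_deriv_mul_eq_sub
    (a := (-1:ℝ)) (b := 1) (fun x _ => p.hasDerivAt x) (fun x _ => q.hasDerivAt x)
    (Continuous.intervalIntegrable (by fun_prop) _ _)
    (Continuous.intervalIntegrable (by fun_prop) _ _)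
  rw [intervalIntegral.integral_add (Continuous.intervalIntegrable (by fun_prop) _ _)
    (Continuous.intervalIntegrable (by fun_prop) _ _), h1, h2] at key
  linarith

lemma pow_dvd_iterate_derivative_pow (n j m : ℕ) (h : m + j ≤ n) :
    (1 - X ^ 2 : ℝ[X]) ^ m ∣ derivative^[j] ((1 - X ^ 2) ^ n) := by
  induction j generalizing m with
  | zero => exact pow_dvd_pow _ h
  | succ j ih =>
    rw [Function.iterate_succ_apply']
    exact pow_dvd_derivative (ih (m + 1) (by omega))

lemma dvd_iterate_derivative_pow {n j : ℕ} (h : j < n) :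
    (1 - X ^ 2 : ℝ[X]) ∣ derivative^[j] ((1 - X ^ 2) ^ n) := by
  simpa using pow_dvd_iterate_derivative_pow n j 1 (by omega)

lemma inner_iterate_derivative (n : ℕ) (q : ℝ[X]) (j : ℕ) (h : j ≤ n) :
    inner ℝ (polyLp (derivative^[j] ((1 - X ^ 2) ^ n))) (polyLp q) =
      (-1) ^ j * inner ℝ (polyLp ((1 - X ^ 2) ^ n)) (polyLp (derivative^[j] q)) := by
  induction j generalizing q with
  | zero => simp
  | succ j ih =>
    rw [Function.iterate_succ_apply', inner_polyLp_derivative (dvd_iterate_derivative_pow (by omega)),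
      ih _ (by omega), ← Function.iterate_succ_apply]
    ring

lemma iterate_derivative_top (n : ℕ) :
    derivative^[2 * n] ((1 - X ^ 2 : ℝ[X]) ^ n) = C ((-1) ^ n * ((2 * n).factorial : ℝ)) := by
  have hdeg : (1 - X ^ 2 : ℝ[X]).natDegree = 2 := by
    compute_degree!
  have hlead : (1 - X ^ 2 : ℝ[X]).leadingCoeff = -1 := by
    rw [leadingCoeff, hdeg]
    simp [coeff_one]
  have h1 : ((1 - X ^ 2 : ℝ[X]) ^ n).natDegree = 2 * n := by
    rw [natDegree_pow, hdeg, mul_comm]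
  have h2 : ((1 - X ^ 2 : ℝ[X]) ^ n).coeff (2 * n) = (-1) ^ n := by
    rw [← h1, coeff_natDegree, leadingCoeff_pow, hlead]
  have h3 : (derivative^[2 * n] ((1 - X ^ 2 : ℝ[X]) ^ n)).natDegree ≤ 0 := by
    refine (natDegree_iterate_derivative _ _).trans ?_
    rw [h1, Nat.sub_self]
  rw [eq_C_of_natDegree_le_zero h3, coeff_iterate_derivative, zero_add, h2, Nat.descFactorial_self,
    nsmul_eq_mul, mul_comm]

lemma norm_polyLp_one_sub_sq_pow_le (n : ℕ) : inner ℝ (polyLp ((1 - X ^ 2) ^ n)) (polyLp 1) ≤ 2 ∧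
    ‖polyLp ((1 - X ^ 2) ^ n)‖ ≤ √2 := by
  have hb : ∀ m : ℕ, ∫ x in (-1:ℝ)..1, (1 - x ^ 2) ^ m ≤ 2 := by
    intro m
    have h : ∫ x in (-1:ℝ)..1, (1 - x ^ 2) ^ m ≤ ∫ x in (-1:ℝ)..1, (1:ℝ) := by
      refine intervalIntegral.integral_mono_on (by norm_num)
        (Continuous.intervalIntegrable (by fun_prop) _ _)
        (Continuous.intervalIntegrable (by fun_prop) _ _) fun x hx => ?_
      exact pow_le_one₀ (by nlinarith [hx.1, hx.2]) (by nlinarith)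
    norm_num at h
    exact h
  constructor
  · rw [inner_polyLp]
    simpa using hb n
  · refine Real.le_sqrt_of_sq_le ?_
    rw [← real_inner_self_eq_norm_sq, inner_polyLp]
    simpa [← pow_add] using hb (n + n)

lemma norm_polyLp_iterate_derivative_top (n : ℕ) :
    ‖polyLp (derivative^[n] ((1 - X ^ 2) ^ n))‖ ^ 2 ≤ 2 * (2 * n).factorial := by
  rw [← real_inner_self_eq_norm_sq, inner_iterate_derivative n _ n le_rfl,
    ← Function.iterate_add_apply, ← two_mul, iterate_derivative_top, C_eq_algebraMap,
    Algebra.algebraMap_eq_smul_one, map_smul, inner_smul_right, ← mul_assoc, ← mul_assoc,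
    ← mul_pow]
  have := (norm_polyLp_one_sub_sq_pow_le n).1
  norm_num
  nlinarith [Nat.cast_nonneg (α := ℝ) (2 * n).factorial]

lemma norm_sq_polyLp_iterate_derivative_le {n j : ℕ} (h0 : 0 < j) (hj : j < n) :
    ‖polyLp (derivative^[j] ((1 - X ^ 2) ^ n))‖ ^ 2 ≤
      ‖polyLp (derivative^[j - 1] ((1 - X ^ 2) ^ n))‖ *
        ‖polyLp (derivative^[j + 1] ((1 - X ^ 2) ^ n))‖ := by
  obtain ⟨i, rfl⟩ : ∃ i, j = i + 1 := ⟨j - 1, by omega⟩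
  rw [← real_inner_self_eq_norm_sq]
  nth_rewrite 1 [Function.iterate_succ_apply']
  rw [inner_polyLp_derivative (dvd_iterate_derivative_pow (by omega)),
    ← Function.iterate_succ_apply' derivative (i + 1), Nat.add_sub_cancel]
  exact (neg_le_abs _).trans (abs_real_inner_le_norm _ _)

lemma le_one_of_sq_le_mul {b : ℕ → ℝ} {n : ℕ} (hb : ∀ j, 0 ≤ b j) (h0 : b 0 ≤ 1) (hn : b n ≤ 1)
    (h : ∀ j, 0 < j → j < n → b j ^ 2 ≤ b (j - 1) * b (j + 1)) {j : ℕ} (hj : j ≤ n) : b j ≤ 1 := by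
  classical
  have hex : ∃ m, m ≤ n ∧ ∀ i ≤ n, b i ≤ b m := by
    obtain ⟨m, hm, hm'⟩ := Finset.exists_max_image (Finset.range (n + 1)) b ⟨0, by simp⟩
    exact ⟨m, by simpa [Nat.lt_succ_iff] using hm,
      fun i hi => hm' i (by simpa [Nat.lt_succ_iff] using hi)⟩
  obtain ⟨hm, hmax⟩ := Nat.find_spec hex
  set m := Nat.find hex with hmdef
  refine (hmax j hj).trans ?_
  by_contra! hgt
  have hm0 : 0 < m := by
    rcases Nat.eq_zero_or_pos m with h' | h'
    · rw [h'] at hgt; linarith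
    · exact h'
  have hmn : m < n := by
    rcases hm.lt_or_eq with h' | h'
    · exact h'
    · rw [h'] at hgt; linarith
  have hlt : b (m - 1) < b m := by
    refine lt_of_le_of_ne (hmax _ (by omega)) fun he => ?_
    exact Nat.find_min hex (show m - 1 < Nat.find hex by omega) ⟨by omega, by rwa [he]⟩
  have h1 := h m hm0 hmn
  have h2 := hmax (m + 1) (by omega)
  nlinarith [hb (m - 1), hb (m + 1)]

lemma norm_polyLp_iterate_derivative_le {n : ℕ} {A : ℝ} (hA : 0 < A)
    (hfac : ((2 * n).factorial : ℝ) ≤ A ^ (2 * n)) {j : ℕ} (hj : j ≤ n) :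
    ‖polyLp (derivative^[j] ((1 - X ^ 2) ^ n))‖ ≤ √2 * A ^ j := by
  have h2 : (0:ℝ) < √2 := by positivity
  have key := le_one_of_sq_le_mul (n := n)
    (b := fun j => ‖polyLp (derivative^[j] ((1 - X ^ 2) ^ n))‖ / (√2 * A ^ j))
    (fun j => by positivity) ?_ ?_ ?_ hj
  · rwa [div_le_one (by positivity)] at key
  · rw [div_le_one (by positivity)]
    simpa using (norm_polyLp_one_sub_sq_pow_le n).2
  · rw [div_le_one (by positivity)]
    refine le_of_sq_le_sq ?_ (by positivity)
    refine (norm_polyLp_iterate_derivative_top n).trans ?_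
    rw [mul_pow, Real.sq_sqrt (by norm_num), ← pow_mul, mul_comm n 2]
    gcongr
  · intro j h0 hj
    have h := norm_sq_polyLp_iterate_derivative_le h0 hj
    rw [div_pow, div_mul_div_comm, mul_mul_mul_comm, ← pow_add, show j - 1 + (j + 1) = j * 2 by omega,
      mul_pow, ← pow_mul, ← sq (√2)]
    gcongr

lemma norm_polyLp_testPoly_le {n : ℕ} {A c τ : ℝ} (hA : 0 < A) (hc : 0 < c) (hτ : 0 < τ)
    (hfac : ((2 * n).factorial : ℝ) ≤ A ^ (2 * n)) (h1 : 2 * A / c ≤ τ)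
    (h2 : 2 * A / c * τ + 1 ≤ τ ^ 2) :
    ∀ k i : ℕ, i + k ≤ n → ‖polyLp (derivative^[i] (testPoly n c k))‖ ≤ √2 * A ^ i * τ ^ k
  | 0, i, h => by
    simpa [testPoly] using norm_polyLp_iterate_derivative_le hA hfac (by omega)
  | 1, i, h => by
    rw [testPoly, ← smul_eq_C_mul, iterate_derivative_smul, ← Function.iterate_succ_apply, map_smul,
      norm_smul, Real.norm_of_nonneg (by positivity)]
    calc 2 / c * ‖polyLp (derivative^[i + 1] ((1 - X ^ 2) ^ n))‖
        ≤ 2 / c * (√2 * A ^ (i + 1)) := by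
          gcongr
          exact norm_polyLp_iterate_derivative_le hA hfac (by omega)
      _ = √2 * A ^ i * (2 * A / c) := by ring
      _ ≤ √2 * A ^ i * τ ^ 1 := by rw [pow_one]; gcongr
  | k + 2, i, h => by
    rw [testPoly, ← smul_eq_C_mul, iterate_map_add, iterate_derivative_smul,
      ← Function.iterate_succ_apply, map_add, map_smul]
    refine (norm_add_le _ _).trans ?_
    rw [norm_smul, Real.norm_of_nonneg (by positivity)]
    calc _ ≤ 2 / c * (√2 * A ^ (i + 1) * τ ^ (k + 1)) + √2 * A ^ i * τ ^ k := by
          gcongr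
          · exact norm_polyLp_testPoly_le hA hc hτ hfac h1 h2 (k + 1) (i + 1) (by omega)
          · exact norm_polyLp_testPoly_le hA hc hτ hfac h1 h2 k i (by omega)
      _ = √2 * A ^ i * τ ^ k * (2 * A / c * τ + 1) := by ring
      _ ≤ √2 * A ^ i * τ ^ k * τ ^ 2 := by gcongr
      _ = _ := by ring

lemma norm_sq_polyLp_sum_testPoly_le {n : ℕ} {A c τ : ℝ} (hA : 0 < A) (hc : 0 < c) (hτ : 1 ≤ τ)
    (hfac : ((2 * n).factorial : ℝ) ≤ A ^ (2 * n)) (h1 : 2 * A / c ≤ τ)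
    (h2 : 2 * A / c * τ + 1 ≤ τ ^ 2) (α : ℕ → ℝ) :
    ‖polyLp (∑ k ∈ Finset.range (n + 1), C (α k) * testPoly n c k)‖ ^ 2 ≤
      2 * (n + 1) * τ ^ (2 * n) * ∑ k ∈ Finset.range (n + 1), α k ^ 2 := by
  have h : ‖polyLp (∑ k ∈ Finset.range (n + 1), C (α k) * testPoly n c k)‖ ≤
      √2 * τ ^ n * ∑ k ∈ Finset.range (n + 1), |α k| := by
    rw [map_sum, Finset.mul_sum]
    refine (norm_sum_le _ _).trans (Finset.sum_le_sum fun k hk => ?_)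
    rw [← smul_eq_C_mul, map_smul, norm_smul, Real.norm_eq_abs, mul_comm]
    have hk' : k ≤ n := by simpa [Nat.lt_succ_iff] using hk
    gcongr
    have := norm_polyLp_testPoly_le hA hc (by linarith) hfac h1 h2 k 0 (by omega)
    simp only [Function.iterate_zero, id, pow_zero, mul_one] at this
    refine this.trans ?_
    gcongr
  have hcs : (∑ k ∈ Finset.range (n + 1), |α k|) ^ 2 ≤
      (n + 1) * ∑ k ∈ Finset.range (n + 1), α k ^ 2 := by
    have := sq_sum_le_card_mul_sum_sq (s := Finset.range (n + 1)) (f := fun k => |α k|)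
    simpa using this
  calc _ ≤ (√2 * τ ^ n * ∑ k ∈ Finset.range (n + 1), |α k|) ^ 2 := by gcongr
    _ = 2 * τ ^ (2 * n) * (∑ k ∈ Finset.range (n + 1), |α k|) ^ 2 := by
      rw [mul_pow, mul_pow, Real.sq_sqrt (by norm_num), ← pow_mul, mul_comm n 2]
    _ ≤ 2 * τ ^ (2 * n) * ((n + 1) * ∑ k ∈ Finset.range (n + 1), α k ^ 2) := by gcongr
    _ = _ := by ring

lemma fourierAt_polyLp (p : ℝ[X]) (s : ℝ) :
    fourierAt (polyLp p) s = fourierAt (fun x => p.eval x) s := by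
  refine integral_congr_ae ?_
  filter_upwards [coeFn_polyLp p] with x hx
  rw [hx]

lemma fourierAt_sum (t : Finset ℕ) (α : ℕ → ℝ) (p : ℕ → ℝ[X]) (s : ℝ) :
    fourierAt (fun x => (∑ k ∈ t, C (α k) * p k).eval x) s =
      ∑ k ∈ t, (α k : ℂ) * fourierAt (fun x => (p k).eval x) s := by
  classical
  induction t using Finset.induction_on with
  | empty => simp [fourierAt]
  | insert a t ha ih =>
    rw [Finset.sum_insert ha, Finset.sum_insert ha, ← ih, ← fourierAt_const_mul, ← fourierAt_add
      ((integrableOn_polynomial _).const_mul _) (integrableOn_polynomial _)]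
    simp

lemma fourierAt_sum_testPoly {n : ℕ} (c : ℝ) (α : ℕ → ℝ) (s : ℝ) :
    fourierAt (polyLp (∑ k ∈ Finset.range (n + 1), C (α k) * testPoly n c k)) s =
      (∑ k ∈ Finset.range (n + 1), ((α k : ℂ) * (-Complex.I) ^ k) *
        (((Chebyshev.U ℝ k).eval (s / c) : ℝ) : ℂ)) *
        fourierAt (fun x => ((1 - X ^ 2 : ℝ[X]) ^ n).eval x) s := by
  rw [fourierAt_polyLp, fourierAt_sum, Finset.sum_mul]
  refine Finset.sum_congr rfl fun k hk => ?_
  rw [fourierAt_testPoly s k (by simpa [Nat.lt_succ_iff] using hk)]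
  ring

lemma le_QForm_sum_testPoly {n : ℕ} {c : ℝ} (hn : 0 < n) (hc : 0 < c) (hcn : c ≤ n)
    (α : ℕ → ℝ) :
    c / 4 * (1 / ((n:ℝ) + 1) * Real.exp (-(c ^ 2 / n))) ^ 2 *
      ∑ k ∈ Finset.range (n + 1), α k ^ 2 ≤
      QForm c (polyLp (∑ k ∈ Finset.range (n + 1), C (α k) * testPoly n c k)) := by
  set η := 1 / ((n:ℝ) + 1) * Real.exp (-(c ^ 2 / n)) with hη
  have hη0 : 0 ≤ η := by positivity
  set G : ℝ → ℂ := fun x => ∑ k ∈ Finset.range (n + 1), ((α k : ℂ) * (-Complex.I) ^ k) *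
        (((Chebyshev.U ℝ k).eval x : ℝ) : ℂ) with hG
  have hGc : Continuous G := by fun_prop
  have hU : Real.pi / 2 * ∑ k ∈ Finset.range (n + 1), α k ^ 2 ≤ ∫ x in (-1:ℝ)..1, ‖G x‖ ^ 2 :=
    sum_sq_le_integral_norm_sq_sum_U (n + 1) α
  have hsub : ∫ s in (-c)..c, ‖G (s / c)‖ ^ 2 = c * ∫ x in (-1:ℝ)..1, ‖G x‖ ^ 2 := by
    rw [intervalIntegral.integral_comp_div (fun x => ‖G x‖ ^ 2) hc.ne', neg_div, div_self hc.ne',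
      smul_eq_mul]
  rw [QForm_eq (integrableOn_of_Lp _) hc.le]
  simp_rw [fourierAt_sum_testPoly]
  have hmono : ∫ s in (-c)..c, η ^ 2 * ‖G (s / c)‖ ^ 2 ≤ ∫ s in (-c)..c, ‖G (s / c) *
      fourierAt (fun x => ((1 - X ^ 2 : ℝ[X]) ^ n).eval x) s‖ ^ 2 := by
    have hcont : Continuous fun s => fourierAt (fun x => ((1 - X ^ 2 : ℝ[X]) ^ n).eval x) s := by
      simp_rw [fourierAt_eq_intervalIntegral]
      exact intervalIntegral.continuous_parametric_intervalIntegral_of_continuous' (by fun_prop) _ _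
    refine intervalIntegral.integral_mono_on (by linarith)
      (Continuous.intervalIntegrable (by fun_prop) _ _)
      (Continuous.intervalIntegrable (by fun_prop) _ _) fun s hs => ?_
    have := pow_le_pow_left₀ hη0 (le_norm_fourierAt_one_sub_sq_pow hn hcn (abs_le.mpr hs)) 2
    rw [norm_mul, mul_pow ‖G _‖, mul_comm (η ^ 2)]
    exact mul_le_mul_of_nonneg_left this (sq_nonneg _)
  rw [intervalIntegral.integral_const_mul, hsub] at hmono
  calc _ = 1 / (2 * Real.pi) * (η ^ 2 * (c * (Real.pi / 2 *
        ∑ k ∈ Finset.range (n + 1), α k ^ 2))) := by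
        field_simp; ring
    _ ≤ 1 / (2 * Real.pi) * (η ^ 2 * (c * ∫ x in (-1:ℝ)..1, ‖G x‖ ^ 2)) := by gcongr
    _ ≤ _ := by gcongr

lemma le_lambda {n : ℕ} {A c τ : ℝ} (hn : 0 < n) (hA : 0 < A) (hc : 0 < c) (hcn : c ≤ n)
    (hτ : 1 ≤ τ) (hfac : ((2 * n).factorial : ℝ) ≤ A ^ (2 * n)) (h1 : 2 * A / c ≤ τ)
    (h2 : 2 * A / c * τ + 1 ≤ τ ^ 2) :
    c * Real.exp (-(2 * c ^ 2 / n)) / (8 * ((n:ℝ) + 1) ^ 3 * τ ^ (2 * n)) ≤ lambda n c := by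
  set η := 1 / ((n:ℝ) + 1) * Real.exp (-(c ^ 2 / n)) with hη
  have hη2 : η ^ 2 = Real.exp (-(2 * c ^ 2 / n)) / ((n:ℝ) + 1) ^ 2 := by
    rw [hη, mul_pow, ← Real.exp_nat_mul]
    push_cast
    rw [show 2 * -(c ^ 2 / (n:ℝ)) = -(2 * c ^ 2 / n) by ring]
    field_simp
  set v : Fin (n + 1) → Lp ℝ 2 (volume.restrict (Set.Ioo (-1:ℝ) 1)) :=
    fun k => polyLp (testPoly n c k) with hv
  have hext : ∀ g : Fin (n + 1) → ℝ, ∃ α : ℕ → ℝ, (∀ i : Fin (n + 1), α i = g i) ∧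
      ∑ i, g i • v i = polyLp (∑ k ∈ Finset.range (n + 1), C (α k) * testPoly n c k) := by
    intro g
    refine ⟨fun k => if h : k < n + 1 then g ⟨k, h⟩ else 0, fun i => dif_pos i.2, ?_⟩
    rw [map_sum, Finset.sum_range]
    refine Finset.sum_congr rfl fun i _ => ?_
    rw [← smul_eq_C_mul, map_smul]
    beta_reduce
    rw [dif_pos i.2]
  have hli : LinearIndependent ℝ v := by
    rw [Fintype.linearIndependent_iff]
    intro g hg i
    obtain ⟨α, hα, hsum⟩ := hext g
    have hQ := le_QForm_sum_testPoly hn hc hcn α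
    rw [← hsum, hg] at hQ
    have hQ0 := QForm_le hc.le (0 : Lp ℝ 2 (volume.restrict (Set.Ioo (-1:ℝ) 1)))
    rw [norm_zero] at hQ0
    have hpos : 0 < c / 4 * η ^ 2 := by positivity
    have hle : ∑ k ∈ Finset.range (n + 1), α k ^ 2 ≤ 0 := by
      by_contra! hcon
      have := mul_pos hpos hcon
      linarith
    have h0 := (Finset.sum_eq_zero_iff_of_nonneg fun k _ => sq_nonneg (α k)).mp
      (hle.antisymm (Finset.sum_nonneg fun k _ => sq_nonneg _)) i (Finset.mem_range.mpr i.2)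
    rw [← hα]
    exact pow_eq_zero_iff (by norm_num) |>.mp h0
  refine le_lambda_of_exists hc.le (Submodule.span ℝ (Set.range v)) ?_ fun f hf => ?_
  · rw [finrank_span_eq_card hli, Fintype.card_fin]
  · obtain ⟨g, rfl⟩ := (Submodule.mem_span_range_iff_exists_fun ℝ).mp hf
    obtain ⟨α, -, hsum⟩ := hext g
    rw [hsum]
    refine le_trans ?_ (le_QForm_sum_testPoly hn hc hcn α)
    have hτ0 : 0 < τ := by linarith
    calc _ ≤ c * Real.exp (-(2 * c ^ 2 / n)) / (8 * ((n:ℝ) + 1) ^ 3 * τ ^ (2 * n)) *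
          (2 * (n + 1) * τ ^ (2 * n) * ∑ k ∈ Finset.range (n + 1), α k ^ 2) := by
          gcongr
          exact norm_sq_polyLp_sum_testPoly_le hA hc hτ hfac h1 h2 α
      _ = _ := by
          rw [← hη, hη2]
          field_simp
          ring

end Polynomials

lemma factorial_le_exp_mul {m : ℕ} (hm : 0 < m) :
    (m.factorial : ℝ) ≤ Real.exp 1 * m * (m / Real.exp 1) ^ m := by
  obtain ⟨k, rfl⟩ : ∃ k, m = k + 1 := ⟨m - 1, by omega⟩
  have h := Stirling.stirlingSeq'_antitone (Nat.zero_le k)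
  simp only [Function.comp_apply, Nat.succ_eq_add_one, zero_add, Stirling.stirlingSeq_one] at h
  unfold Stirling.stirlingSeq at h
  have h0 : (0:ℝ) < ((k + 1 : ℕ) : ℝ) := by positivity
  have h1 : (1:ℝ) ≤ ((k + 1 : ℕ) : ℝ) := by exact_mod_cast (by omega : 1 ≤ k + 1)
  generalize ((k + 1 : ℕ) : ℝ) = x at *
  rw [div_le_iff₀ (by positivity)] at h
  refine h.trans ?_
  rw [Real.sqrt_mul (by norm_num)]
  have h2 : √x ≤ x := Real.sqrt_le_iff.mpr ⟨h0.le, by nlinarith⟩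
  calc Real.exp 1 / √2 * (√2 * √x * (x / Real.exp 1) ^ (k + 1))
      = Real.exp 1 * √x * (x / Real.exp 1) ^ (k + 1) := by field_simp
    _ ≤ _ := by gcongr

lemma exists_forall_mul_pow_lt {t : ℝ} (ht : 1 < t) (K : ℝ) (k : ℕ) :
    ∃ N : ℕ, ∀ n : ℕ, N ≤ n → K * (n:ℝ) ^ k < t ^ n := by
  have h := (tendsto_pow_const_div_const_pow_of_one_lt k ht).const_mul K
  rw [mul_zero] at h
  obtain ⟨N, hN⟩ := Filter.eventually_atTop.mp (h.eventually_lt_const one_pos)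
  refine ⟨N, fun n hn => ?_⟩
  have := hN n hn
  rwa [← mul_div_assoc, div_lt_one (by positivity)] at this

lemma exp_neg_mul_log {n : ℕ} {y : ℝ} (hy : 0 < y) :
    Real.exp (-(2 * (n:ℝ)) * Real.log y) = (y ^ (2 * n))⁻¹ := by
  rw [neg_mul, Real.exp_neg, mul_comm, Real.exp_mul, Real.exp_log hy]
  norm_cast

lemma exp_lt_lambda {b : ℝ} (hb : 4 / Real.exp 1 < b) :
    ∃ Mb : ℝ, ∀ c : ℝ, 1 ≤ c → ∀ n : ℕ, c * Mb ≤ (n:ℝ) →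
      Real.exp (-(2*(n:ℝ)) * Real.log (b*n/c)) < lambda n c := by
  have he : 0 < Real.exp 1 := Real.exp_pos 1
  have he4 : Real.exp 1 ≤ 4 := by linarith [Real.exp_one_lt_d9]
  obtain ⟨t, ht, htb⟩ : ∃ t : ℝ, 1 < t ∧ b = 4 * t ^ 4 / Real.exp 1 := by
    rw [div_lt_iff₀ he] at hb
    refine ⟨√√(b * Real.exp 1 / 4), ?_, ?_⟩
    · rw [Real.lt_sqrt one_pos.le, Real.lt_sqrt (by norm_num)]
      linarith
    · rw [show 4 = 2 * 2 by norm_num, pow_mul, Real.sq_sqrt (by positivity),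
        Real.sq_sqrt (by linarith)]
      field_simp
  have hlog : 0 < Real.log t := Real.log_pos ht
  obtain ⟨N, hN⟩ := exists_forall_mul_pow_lt ht 64 3
  refine ⟨1 + 1 / (t - 1) + 2 / Real.log t + N, fun c hc n hn => ?_⟩
  obtain ⟨M, hM⟩ : ∃ M, M = 1 + 1 / (t - 1) + 2 / Real.log t + (N:ℝ) := ⟨_, rfl⟩
  rw [← hM] at hn
  have ht1 : 0 < t - 1 := by linarith
  have hM1 : 1 ≤ M := by
    have : 0 ≤ 1 / (t - 1) + 2 / Real.log t + (N:ℝ) := by positivity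
    linarith
  have hMt : 1 ≤ M * (t - 1) := by
    rw [← div_le_iff₀ ht1]
    have : 0 ≤ 2 / Real.log t + (N:ℝ) := by positivity
    linarith
  have hMl : 2 ≤ M * Real.log t := by
    rw [← div_le_iff₀ hlog]
    have : 0 ≤ 1 / (t - 1) + (N:ℝ) := by positivity
    linarith
  have hMN : (N:ℝ) ≤ M := by
    have : 0 ≤ 1 / (t - 1) + 2 / Real.log t := by positivity
    linarith
  have hMn : M ≤ n := by nlinarith
  have hn1 : (1:ℝ) ≤ n := by linarith
  have hn0 : 0 < n := by exact_mod_cast (by linarith : (0:ℝ) < n)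
  have hc0 : 0 < c := by linarith
  have hpow := hN n (by exact_mod_cast hMN.trans hMn)
  have hcn : c ≤ n := by nlinarith
  obtain ⟨A, hA⟩ : ∃ A, A = t * (2 * n / Real.exp 1) := ⟨_, rfl⟩
  obtain ⟨τ, hτ⟩ : ∃ τ, τ = 2 * A / c * t := ⟨_, rfl⟩
  have hA0 : 0 < A := by rw [hA]; positivity
  have hAM : M ≤ 2 * A / c := by
    rw [le_div_iff₀ hc0, hA, mul_comm M]
    refine hn.trans ?_
    rw [show 2 * (t * (2 * (n:ℝ) / Real.exp 1)) = (4 * t * n) / Real.exp 1 by ring,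
      le_div_iff₀ he]
    nlinarith
  have hfac : ((2 * n).factorial : ℝ) ≤ A ^ (2 * n) := by
    refine (factorial_le_exp_mul (by omega)).trans ?_
    rw [hA, mul_pow]
    push_cast
    gcongr
    have h1 : t ^ n ≤ t ^ (2 * n) := pow_le_pow_right₀ ht.le (by omega)
    have h2 : (1:ℝ) ≤ (n:ℝ) ^ 2 := by nlinarith
    nlinarith
  have hτ1 : 2 * A / c ≤ τ := by
    rw [hτ]; nlinarith
  have hlam := le_lambda (τ := τ) hn0 hA0 hc0 hcn (by linarith) hfac hτ1 (by
    rw [hτ]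
    have h1 : M * M ≤ 2 * A / c * (2 * A / c) := by gcongr
    have h2 : 1 ≤ 2 * A / c * (2 * A / c) * (t - 1) := by
      nlinarith
    nlinarith)
  refine lt_of_lt_of_le ?_ hlam
  have hτ0 : 0 < τ := by linarith
  have hy : b * n / c = t ^ 2 * τ := by
    rw [htb, hτ, hA]
    field_simp
    norm_num
  rw [hy, exp_neg_mul_log (by positivity), mul_pow, inv_eq_one_div, div_lt_div_iff₀ (by positivity)
    (by positivity), Real.exp_neg]
  have hexp : Real.exp (2 * c ^ 2 / n) ≤ t ^ n := by
    rw [← Real.exp_log (by linarith : 0 < t), ← Real.exp_nat_mul]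
    refine Real.exp_le_exp.mpr ?_
    rw [div_le_iff₀ (by linarith)]
    have h1 : c * M * (c * M) ≤ n * n := by gcongr
    have h2 : 2 ≤ M * M * Real.log t := by
      rw [mul_assoc]
      exact hMl.trans (le_mul_of_one_le_left (by linarith) hM1)
    calc 2 * c ^ 2 ≤ M * M * Real.log t * c ^ 2 := by gcongr
      _ = c * M * (c * M) * Real.log t := by ring
      _ ≤ n * n * Real.log t := by gcongr
      _ = _ := by ring
  have h8 : 8 * ((n:ℝ) + 1) ^ 3 ≤ 64 * (n:ℝ) ^ 3 := by
    have : ((n:ℝ) + 1) ^ 3 ≤ (2 * n) ^ 3 := by gcongr; linarith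
    rw [mul_pow] at this
    norm_num at this
    linarith
  have htn : 1 ≤ t ^ n := one_le_pow₀ ht.le
  have hinv : (t ^ n)⁻¹ ≤ (Real.exp (2 * c ^ 2 / n))⁻¹ := inv_anti₀ (Real.exp_pos _) hexp
  have ht4 : (t ^ 2) ^ (2 * n) = t ^ n * t ^ n * t ^ n * t ^ n := by ring
  rw [ht4, one_mul]
  have hτn : 0 < τ ^ (2 * n) := by positivity
  calc 8 * ((n:ℝ) + 1) ^ 3 * τ ^ (2 * n) < t ^ n * τ ^ (2 * n) := by gcongr; linarith
    _ ≤ (t ^ n * t ^ n) * (t ^ n * τ ^ (2 * n)) := by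
      refine le_mul_of_one_le_left (by positivity) (one_le_mul_of_one_le_of_one_le htn htn)
    _ = 1 * (t ^ n)⁻¹ * (t ^ n * t ^ n * t ^ n * t ^ n * τ ^ (2 * n)) := by field_simp
    _ ≤ _ := by gcongr

/-- The exponential `t ↦ exp (i s t)` as a continuous map. -/
noncomputable def expMap (s : ℝ) : C(ℝ, ℂ) where
  toFun t := Complex.exp (((s * t : ℝ) : ℂ) * Complex.I)
  continuous_toFun := by fun_prop

lemma expMap_apply (s t : ℝ) : expMap s t = Complex.exp (((s * t : ℝ) : ℂ) * Complex.I) := rfl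

lemma norm_expMap (s t : ℝ) : ‖expMap s t‖ = 1 := by
  rw [expMap_apply, Complex.norm_exp_ofReal_mul_I]

lemma hasDerivAt_expMap (s x : ℝ) : HasDerivAt (expMap s) (Complex.I * s * expMap s x) x :=
  (hasDerivAt_exp_ofReal_mul_I s x).congr_deriv (by rw [expMap_apply]; ring)

lemma expMap_neg_mul (s t : ℝ) : expMap s t * expMap (-s) t = 1 := by
  rw [expMap_apply, expMap_apply, ← Complex.exp_add]
  push_cast
  simp

/-- The Volterra operator `φ ↦ φ + i ω exp (i ω t) ∫_{-1}^t exp (-i ω x) φ x`. -/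
noncomputable def volterra (ω : ℝ) : C(ℝ, ℂ) →ₗ[ℂ] C(ℝ, ℂ) where
  toFun φ :=
    { toFun := fun t => φ t + Complex.I * ω * expMap ω t * ∫ x in (-1:ℝ)..t, expMap (-ω) x * φ x
      continuous_toFun := by
        have := intervalIntegral.continuous_primitive (μ := volume)
          (f := fun x => expMap (-ω) x * φ x)
          (fun a b => Continuous.intervalIntegrable (by fun_prop) _ _) (-1)
        fun_prop }
  map_add' φ ψ := by
    ext t
    simp only [ContinuousMap.coe_mk, ContinuousMap.add_apply, mul_add]
    rw [intervalIntegral.integral_add (Continuous.intervalIntegrable (by fun_prop) _ _)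
      (Continuous.intervalIntegrable (by fun_prop) _ _)]
    ring
  map_smul' r φ := by
    ext t
    simp only [ContinuousMap.coe_mk, ContinuousMap.smul_apply, smul_eq_mul, RingHom.id_apply,
      mul_left_comm _ r]
    rw [intervalIntegral.integral_const_mul]
    ring

lemma volterra_apply (ω : ℝ) (φ : C(ℝ, ℂ)) (t : ℝ) : volterra ω φ t =
    φ t + Complex.I * ω * expMap ω t * ∫ x in (-1:ℝ)..t, expMap (-ω) x * φ x := rfl

lemma volterra_deriv_sub (ω : ℝ) {q q' : C(ℝ, ℂ)} (h : ∀ x, HasDerivAt q (q' x) x) :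
    ∃ C : ℂ, volterra ω (q' - (Complex.I * ω) • q) = q' - C • expMap ω := by
  refine ⟨Complex.I * ω * expMap (-ω) (-1) * q (-1), ?_⟩
  ext t
  have hint : ∫ x in (-1:ℝ)..t, expMap (-ω) x * (q' - (Complex.I * ω) • q) x =
      expMap (-ω) t * q t - expMap (-ω) (-1) * q (-1) := by
    refine intervalIntegral.integral_eq_sub_of_hasDerivAt (f := fun x => expMap (-ω) x * q x)
      (fun x _ => ?_) (Continuous.intervalIntegrable (by fun_prop) _ _)
    refine ((hasDerivAt_expMap (-ω) x).mul (h x)).congr_deriv ?_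
    simp only [ContinuousMap.sub_apply, ContinuousMap.smul_apply, smul_eq_mul]
    push_cast
    ring
  rw [volterra_apply, hint]
  simp only [ContinuousMap.sub_apply, ContinuousMap.smul_apply, smul_eq_mul]
  linear_combination (Complex.I * ω * q t) * expMap_neg_mul ω t

lemma norm_volterra_le {ω c κ K : ℝ} (hκ : 0 < κ) (hω : |ω| ≤ c) {φ : C(ℝ, ℂ)}
    (hφ : ∀ t ∈ Set.Icc (-1:ℝ) 1, ‖φ t‖ ≤ K * Real.exp (κ * (t + 1))) :
    ∀ t ∈ Set.Icc (-1:ℝ) 1, ‖volterra ω φ t‖ ≤ (1 + c / κ) * K * Real.exp (κ * (t + 1)) := by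
  intro t ht
  have hK : 0 ≤ K := by
    have := (norm_nonneg _).trans (hφ t ht)
    exact nonneg_of_mul_nonneg_left this (Real.exp_pos _)
  have hint : ∫ x in (-1:ℝ)..t, K * Real.exp (κ * (x + 1)) =
      K / κ * Real.exp (κ * (t + 1)) - K / κ := by
    rw [intervalIntegral.integral_eq_sub_of_hasDerivAt
      (f := fun x => K / κ * Real.exp (κ * (x + 1))) (fun x _ => ?_)
      (Continuous.intervalIntegrable (by fun_prop) _ _)]
    · simp
    · have h1 : HasDerivAt (fun x => κ * (x + 1)) κ x := by
        simpa using ((hasDerivAt_id x).add_const 1).const_mul κ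
      exact (h1.exp.const_mul (K / κ)).congr_deriv (by field_simp)
  have hle : ‖∫ x in (-1:ℝ)..t, expMap (-ω) x * φ x‖ ≤ K / κ * Real.exp (κ * (t + 1)) := by
    have h1 : ‖∫ x in (-1:ℝ)..t, expMap (-ω) x * φ x‖ ≤
        ∫ x in (-1:ℝ)..t, K * Real.exp (κ * (x + 1)) := by
      refine intervalIntegral.norm_integral_le_of_norm_le ht.1
        (Filter.Eventually.of_forall fun x hx => ?_)
        (Continuous.intervalIntegrable (by fun_prop) _ _)
      rw [norm_mul, norm_expMap, one_mul]
      exact hφ x ⟨hx.1.le, hx.2.trans ht.2⟩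
    rw [hint] at h1
    have : 0 ≤ K / κ := by positivity
    linarith
  rw [volterra_apply]
  refine (norm_add_le _ _).trans ?_
  rw [norm_mul, norm_mul, norm_mul, norm_expMap, Complex.norm_I, Complex.norm_real,
    Real.norm_eq_abs, one_mul, mul_one]
  calc _ ≤ K * Real.exp (κ * (t + 1)) + c * (K / κ * Real.exp (κ * (t + 1))) := by
        gcongr
        · exact hφ t ht
        · exact (abs_nonneg _).trans hω
    _ = _ := by ring

/-- Successive composition of a functional with the Volterra operators at the nodes `ω j`. -/
noncomputable def volterraIter (Λ : C(ℝ, ℂ) →ₗ[ℂ] ℂ) (ω : ℕ → ℝ) : ℕ → C(ℝ, ℂ) →ₗ[ℂ] ℂ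
  | 0 => Λ
  | k + 1 => volterraIter Λ ω k ∘ₗ volterra (ω k)

lemma norm_volterraIter_le {Λ : C(ℝ, ℂ) →ₗ[ℂ] ℂ} {ω : ℕ → ℝ} {c κ B : ℝ} (hκ : 0 < κ)
    (hΛ : ∀ φ K, (∀ t ∈ Set.Icc (-1:ℝ) 1, ‖φ t‖ ≤ K * Real.exp (κ * (t + 1))) → ‖Λ φ‖ ≤ B * K)
    (k : ℕ) (hω : ∀ j < k, |ω j| ≤ c) (φ : C(ℝ, ℂ)) (K : ℝ)
    (hφ : ∀ t ∈ Set.Icc (-1:ℝ) 1, ‖φ t‖ ≤ K * Real.exp (κ * (t + 1))) :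
    ‖volterraIter Λ ω k φ‖ ≤ B * ((1 + c / κ) ^ k * K) := by
  induction k generalizing φ K with
  | zero => simpa [volterraIter] using hΛ φ K hφ
  | succ k ih =>
    have := ih (fun j hj => hω j (by omega)) _ _ (norm_volterra_le hκ (hω k (by omega)) hφ)
    rw [pow_succ, mul_assoc ((1 + c / κ) ^ k)]
    exact this

lemma prod_mul_volterraIter_expMap {Λ : C(ℝ, ℂ) →ₗ[ℂ] ℂ} {ω : ℕ → ℝ} (k : ℕ)
    (hinj : ∀ i < k, ∀ j < i, ω i ≠ ω j) (h0 : ∀ j < k, Λ (expMap (ω j)) = 0) (s : ℝ) :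
    (∏ j ∈ Finset.range k, ((s : ℂ) - ω j)) * volterraIter Λ ω k (expMap s) =
      s ^ k * Λ (expMap s) := by
  induction k generalizing s with
  | zero => simp [volterraIter]
  | succ k ih =>
    have ih' := ih (fun i hi => hinj i (by omega)) (fun j hj => h0 j (by omega))
    have hz : volterraIter Λ ω k (expMap (ω k)) = 0 := by
      have h1 := ih' (ω k)
      rw [h0 k (by omega), mul_zero] at h1
      refine (mul_eq_zero.mp h1).resolve_left (Finset.prod_ne_zero_iff.mpr fun j hj => ?_)
      have := hinj k (by omega) j (by simpa using hj)
      exact sub_ne_zero.mpr (by exact_mod_cast this)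
    obtain ⟨C, hC⟩ := volterra_deriv_sub (ω k) (q := expMap s)
      (q' := (Complex.I * s) • expMap s) (fun x => by simpa using hasDerivAt_expMap s x)
    have h2 := congrArg (volterraIter Λ ω k) hC
    simp only [map_sub, map_smul, smul_eq_mul, hz] at h2
    have h3 : ((s : ℂ) - ω k) * volterraIter Λ ω k (volterra (ω k) (expMap s)) =
        s * volterraIter Λ ω k (expMap s) := by
      refine mul_left_cancel₀ Complex.I_ne_zero ?_
      linear_combination h2
    rw [Finset.prod_range_succ, volterraIter, LinearMap.comp_apply, mul_assoc, h3]
    linear_combination (s:ℂ) * ih' s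

/-- A complex polynomial restricted to the real line, as a continuous map. -/
noncomputable def polyMap : Polynomial ℂ →ₗ[ℂ] C(ℝ, ℂ) where
  toFun p := ⟨fun t => p.eval (t : ℂ), by fun_prop⟩
  map_add' p q := by ext; simp
  map_smul' r p := by ext; simp

lemma hasDerivAt_polyMap (p : Polynomial ℂ) (x : ℝ) :
    HasDerivAt (polyMap p) (polyMap (Polynomial.derivative p) x) x :=
  (p.hasDerivAt (x : ℂ)).comp_ofReal

lemma volterraIter_polyMap {Λ : C(ℝ, ℂ) →ₗ[ℂ] ℂ} {ω : ℕ → ℝ} (k : ℕ)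
    (hinj : ∀ i < k, ∀ j < i, ω i ≠ ω j) (h0 : ∀ j < k, Λ (expMap (ω j)) = 0)
    (hω : ∀ j < k, ω j ≠ 0) (p : Polynomial ℂ) (hp : p.natDegree < k) :
    volterraIter Λ ω k (polyMap p) = 0 := by
  induction k generalizing p with
  | zero => omega
  | succ k ih =>
    have ih' := ih (fun i hi => hinj i (by omega)) (fun j hj => h0 j (by omega))
      (fun j hj => hω j (by omega))
    have hz : volterraIter Λ ω k (expMap (ω k)) = 0 := by
      have h1 := prod_mul_volterraIter_expMap k (fun i hi => hinj i (by omega))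
        (fun j hj => h0 j (by omega)) (ω k)
      rw [h0 k (by omega), mul_zero] at h1
      refine (mul_eq_zero.mp h1).resolve_left (Finset.prod_ne_zero_iff.mpr fun j hj => ?_)
      have := hinj k (by omega) j (by simpa using hj)
      exact sub_ne_zero.mpr (by exact_mod_cast this)
    have step : ∀ q : Polynomial ℂ, q.natDegree < k + 1 →
        volterraIter Λ ω (k + 1) (polyMap (Polynomial.derivative q)) = 0 →
        volterraIter Λ ω (k + 1) (polyMap q) = 0 := by
      intro q hq hq'
      obtain ⟨C, hC⟩ := volterra_deriv_sub (ω k) (hasDerivAt_polyMap q)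
      have h2 := congrArg (volterraIter Λ ω k) hC
      have h3 : volterraIter Λ ω k (polyMap (Polynomial.derivative q)) = 0 := by
        rcases Nat.eq_zero_or_pos q.natDegree with hd | hd
        · rw [Polynomial.derivative_of_natDegree_zero hd, map_zero, map_zero]
        · exact ih' _ (by have := Polynomial.natDegree_derivative_lt hd.ne'; omega)
      simp only [volterraIter, LinearMap.comp_apply] at hq' ⊢
      simp only [map_sub, map_smul, smul_eq_mul, hz, h3, hq', mul_zero, sub_zero, zero_sub,
        neg_eq_zero] at h2
      refine (mul_eq_zero.mp h2).resolve_left (mul_ne_zero Complex.I_ne_zero ?_)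
      exact_mod_cast hω k (by omega)
    induction hd : p.natDegree using Nat.strong_induction_on generalizing p with
    | _ d ihd =>
      refine step p hp ?_
      rcases Nat.eq_zero_or_pos p.natDegree with h | h
      · rw [Polynomial.derivative_of_natDegree_zero h, map_zero, map_zero]
      · have := Polynomial.natDegree_derivative_lt h.ne'
        exact ihd _ (by omega) _ (by omega) rfl

lemma norm_le_of_vanishing {Λ : C(ℝ, ℂ) →ₗ[ℂ] ℂ} {ω : ℕ → ℝ} {c κ B ε s : ℝ} {N : ℕ} (hκ : 0 < κ)
    (hΛ : ∀ φ K, (∀ t ∈ Set.Icc (-1:ℝ) 1, ‖φ t‖ ≤ K * Real.exp (κ * (t + 1))) → ‖Λ φ‖ ≤ B * K)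
    (hωc : ∀ j < N, |ω j| ≤ c) (hinj : ∀ i < N, ∀ j < i, ω i ≠ ω j)
    (h0 : ∀ j < N, Λ (expMap (ω j)) = 0) (hω : ∀ j < N, ω j ≠ 0)
    (hε : 0 ≤ ε) (p : Polynomial ℂ) (hp : p.natDegree < N)
    (happ : ∀ t ∈ Set.Icc (-1:ℝ) 1, ‖expMap s t - p.eval (t : ℂ)‖ ≤ ε) :
    |s| ^ N * ‖Λ (expMap s)‖ ≤
      |∏ j ∈ Finset.range N, (s - ω j)| * (B * ((1 + c / κ) ^ N * ε)) := by
  have h1 := norm_volterraIter_le hκ hΛ N hωc (expMap s - polyMap p) ε (fun t ht => by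
    refine (happ t ht).trans (le_mul_of_one_le_right hε (Real.one_le_exp ?_))
    have := ht.1
    exact mul_nonneg hκ.le (by linarith))
  rw [map_sub, volterraIter_polyMap N hinj h0 hω p hp, sub_zero] at h1
  have h2 := congrArg norm (prod_mul_volterraIter_expMap (Λ := Λ) N hinj h0 s)
  rw [norm_mul, norm_mul, norm_pow, Complex.norm_real, Real.norm_eq_abs] at h2
  have h3 : ‖∏ j ∈ Finset.range N, ((s : ℂ) - ω j)‖ = |∏ j ∈ Finset.range N, (s - ω j)| := by
    rw [← Real.norm_eq_abs, ← Complex.norm_real]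
    push_cast
    rfl
  rw [← h2, h3]
  gcongr

/-- Generalized Rolle theorem: if `F (k + 1)` is the derivative of `F k` for every `k` and `F 0`
has at least `n + 1` zeros, then `F n` has a zero. -/
lemma exists_eq_zero_of_strict_zeros (n : ℕ) {F : ℕ → ℝ → ℝ}
    (hF : ∀ k x, HasDerivAt (F k) (F (k + 1) x) x) {z : ℕ → ℝ}
    (hz : ∀ j < n, z j < z (j + 1)) (h0 : ∀ j ≤ n, F 0 (z j) = 0) : ∃ x, F n x = 0 := by
  induction n generalizing F z with
  | zero => exact ⟨z 0, h0 0 le_rfl⟩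
  | succ n ih =>
    have h : ∀ j, ∃ ξ, j ≤ n → ξ ∈ Set.Ioo (z j) (z (j + 1)) ∧ F 1 ξ = 0 := fun j => by
      by_cases hj : j ≤ n
      · obtain ⟨ξ, h1, h2⟩ := exists_hasDerivAt_eq_zero (hz j (by omega))
          (fun x _ => (hF 0 x).continuousAt.continuousWithinAt)
          ((h0 j (by omega)).trans (h0 (j + 1) (by omega)).symm) (fun x _ => hF 0 x)
        exact ⟨ξ, fun _ => ⟨h1, h2⟩⟩
      · exact ⟨0, fun h => absurd h hj⟩
    choose ξ hξ using h
    exact ih (F := fun k => F (k + 1)) (fun k => hF (k + 1))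
      (fun j hj => (hξ j hj.le).1.2.trans (hξ (j + 1) hj).1.1) (fun j hj => (hξ j hj).2)

lemma exists_eq_zero_of_card_zeros {n : ℕ} {F : ℕ → ℝ → ℝ}
    (hF : ∀ k x, HasDerivAt (F k) (F (k + 1) x) x) (S : Finset ℝ) (hS : S.card = n + 1)
    (h0 : ∀ x ∈ S, F 0 x = 0) : ∃ x, F n x = 0 := by
  refine exists_eq_zero_of_strict_zeros n hF
    (z := fun j => if h : j < n + 1 then S.orderEmbOfFin hS ⟨j, h⟩ else 0)
    (fun j hj => ?_) (fun j hj => ?_)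
  · simp [show j < n + 1 by omega, hj]
  · simp only [show j < n + 1 by omega, dite_true]
    exact h0 _ (S.orderEmbOfFin_mem hS _)

/-- Error bound for Lagrange interpolation. -/
lemma abs_sub_interpolate_le {f : ℕ → ℝ → ℝ} (hf : ∀ k x, HasDerivAt (f k) (f (k + 1) x) x)
    (S : Finset ℝ) {C : ℝ} (hC : ∀ x, |f S.card x| ≤ C) (t : ℝ) :
    |f 0 t - (Lagrange.interpolate S id (f 0)).eval t| ≤
      C / S.card.factorial * |∏ x ∈ S, (t - x)| := by
  obtain ⟨P, hP⟩ : ∃ P, P = Lagrange.interpolate S id (f 0) := ⟨_, rfl⟩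
  have hPe : ∀ x ∈ S, P.eval x = f 0 x := fun x hx => by
    rw [hP]; exact Lagrange.eval_interpolate_at_node (f 0) Function.injective_id.injOn hx
  have hPd : P.degree < S.card := by
    rw [hP]; exact Lagrange.degree_interpolate_lt _ Function.injective_id.injOn
  rw [← hP]
  by_cases ht : t ∈ S
  · rw [hPe t ht, Finset.prod_eq_zero ht (sub_self t)]
    simp
  have hw : ∏ x ∈ S, (t - x) ≠ 0 :=
    Finset.prod_ne_zero_iff.mpr fun x hx => sub_ne_zero.mpr fun h => ht (h ▸ hx)
  obtain ⟨K, hK⟩ : ∃ K, K = (f 0 t - P.eval t) / ∏ x ∈ S, (t - x) := ⟨_, rfl⟩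
  obtain ⟨R, hR⟩ : ∃ R, R = P + Polynomial.C K * ∏ x ∈ S, (Polynomial.X - Polynomial.C x) :=
    ⟨_, rfl⟩
  obtain ⟨x, hx⟩ := exists_eq_zero_of_card_zeros (n := S.card)
    (F := fun k y => f k y - (Polynomial.derivative^[k] R).eval y)
    (fun k x => by
      rw [Function.iterate_succ_apply']
      exact (hf k x).sub (Polynomial.hasDerivAt _ x))
    (insert t S) (Finset.card_insert_of_notMem ht) (fun y hy => by
      rcases Finset.mem_insert.mp hy with rfl | hy
      · simp [hR, Polynomial.eval_prod, hK, hw]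
      · simp [hR, Polynomial.eval_prod, hPe y hy, Finset.prod_eq_zero hy (sub_self y)])
  have hRN : Polynomial.derivative^[S.card] R = Polynomial.C (K * S.card.factorial) := by
    rw [hR, iterate_map_add,
      Polynomial.iterate_derivative_eq_zero_of_degree_lt hPd, Polynomial.iterate_derivative_C_mul,
      Polynomial.iterate_derivative_prod_X_sub_C le_rfl]
    simp
  rw [hRN, Polynomial.eval_C] at hx
  have hKx : K = f S.card x / S.card.factorial := by
    field_simp
    linarith
  have h1 : f 0 t - P.eval t = K * ∏ x ∈ S, (t - x) := by rw [hK]; field_simp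
  rw [h1, abs_mul, hKx, abs_div, Nat.abs_cast]
  gcongr
  exact hC x

/-- The zeros of the Chebyshev polynomial of degree `N`. -/
noncomputable def chebNode (N j : ℕ) : ℝ := Real.cos ((2 * j + 1) * Real.pi / (2 * N))

lemma abs_chebNode_le_one (N j : ℕ) : |chebNode N j| ≤ 1 := Real.abs_cos_le_one _

lemma injOn_chebNode (N : ℕ) : Set.InjOn (chebNode N) (Finset.range N) :=
  (Finset.range N).nodup_map_iff_injOn.mp (Polynomial.Chebyshev.roots_T_real_nodup N)

lemma chebNode_reflect {N j : ℕ} (hj : j < N) : chebNode N (N - 1 - j) = -chebNode N j := by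
  rw [chebNode, chebNode, ← Real.cos_pi_sub]
  congr 1
  have hN : (N:ℝ) ≠ 0 := by norm_cast; omega
  rw [show N - 1 - j = N - (j + 1) by omega, Nat.cast_sub (by omega)]
  push_cast
  field_simp
  ring

lemma chebNode_ne_zero {N j : ℕ} (hN : Even N) (hj : j < N) : chebNode N j ≠ 0 := by
  intro h
  have h1 := injOn_chebNode N (x₁ := N - 1 - j) (x₂ := j) (by simp; omega) (by simpa using hj)
    ((chebNode_reflect hj).trans (by rw [h, neg_zero]))
  obtain ⟨m, hm⟩ := hN
  omega

lemma abs_prod_sub_chebNode_le {N : ℕ} {x : ℝ} (hx : |x| ≤ 1) :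
    |∏ j ∈ Finset.range N, (x - chebNode N j)| ≤ 2 / 2 ^ N := by
  have hr : (Polynomial.Chebyshev.T ℝ N).roots = ((Finset.range N).image (chebNode N)).val :=
    Polynomial.Chebyshev.roots_T_real N
  have hcard : (Polynomial.Chebyshev.T ℝ N).roots.card =
      (Polynomial.Chebyshev.T ℝ N).natDegree := by
    rw [hr, Finset.card_val, Polynomial.Chebyshev.natDegree_T]
    simpa using Finset.card_image_of_injOn (injOn_chebNode N)
  have h := congrArg (Polynomial.eval x) (Polynomial.C_leadingCoeff_mul_prod_multiset_X_sub_C hcard)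
  have h2 := Polynomial.Chebyshev.abs_eval_T_real_le_one N hx
  rw [hr, ← Finset.prod_eq_multiset_prod, Finset.prod_image (injOn_chebNode N),
    Polynomial.Chebyshev.leadingCoeff_T] at h
  rw [← h] at h2
  simp only [Polynomial.eval_mul, Polynomial.eval_C, Polynomial.eval_prod, Polynomial.eval_sub,
    Polynomial.eval_X, abs_mul, Int.natAbs_natCast, abs_pow, Nat.abs_ofNat] at h2
  rw [le_div_iff₀ (by positivity), mul_comm]
  rcases N with _ | N
  · simp
  · rw [pow_succ']
    simp only [Nat.add_sub_cancel] at h2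
    rw [mul_assoc]
    exact mul_le_of_le_one_right (by norm_num) h2

lemma hasDerivAt_pow_mul_cos (s θ : ℝ) (k : ℕ) (x : ℝ) :
    HasDerivAt (fun x => s ^ k * Real.cos (s * x + θ + k * (Real.pi / 2)))
      (s ^ (k + 1) * Real.cos (s * x + θ + (k + 1 : ℕ) * (Real.pi / 2))) x := by
  have h1 : HasDerivAt (fun x => s * x + θ + k * (Real.pi / 2)) s x := by
    simpa using (((hasDerivAt_id x).const_mul s).add_const θ).add_const (k * (Real.pi / 2))
  refine (h1.cos.const_mul (s ^ k)).congr_deriv ?_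
  rw [show s * x + θ + ((k + 1 : ℕ) : ℝ) * (Real.pi / 2) =
    s * x + θ + k * (Real.pi / 2) + Real.pi / 2 by push_cast; ring, Real.cos_add_pi_div_two]
  ring

lemma exists_poly_cos_approx (s θ : ℝ) {N : ℕ} (hN : 0 < N) : ∃ P : Polynomial ℝ,
    P.natDegree < N ∧ ∀ t ∈ Set.Icc (-1:ℝ) 1,
      |Real.cos (s * t + θ) - P.eval t| ≤ |s| ^ N / N.factorial * (2 / 2 ^ N) := by
  obtain ⟨S, hS⟩ : ∃ S, S = (Finset.range N).image (chebNode N) := ⟨_, rfl⟩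
  have hcard : S.card = N := by
    rw [hS, Finset.card_image_of_injOn (injOn_chebNode N), Finset.card_range]
  obtain ⟨P, hP⟩ : ∃ P, P = Lagrange.interpolate S id (fun x => Real.cos (s * x + θ)) := ⟨_, rfl⟩
  refine ⟨P, ?_, fun t ht =>
    le_trans (b := |s| ^ N / N.factorial * |∏ x ∈ S, (t - x)|) ?_ ?_⟩
  · rcases eq_or_ne P 0 with h | h
    · simpa [h] using hN
    · rw [Polynomial.natDegree_lt_iff_degree_lt h, hP, ← hcard]
      exact Lagrange.degree_interpolate_lt _ Function.injective_id.injOn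
  · have := abs_sub_interpolate_le (hasDerivAt_pow_mul_cos s θ) S (C := |s| ^ N)
      (fun x => by
        rw [abs_mul, abs_pow, hcard]
        exact mul_le_of_le_one_right (by positivity) (Real.abs_cos_le_one _)) t
    simpa [hcard, hP] using this
  · rw [hS, Finset.prod_image (injOn_chebNode N)]
    gcongr
    exact abs_prod_sub_chebNode_le (abs_le.mpr ht)

lemma exists_poly_expMap_approx (s : ℝ) {N : ℕ} (hN : 0 < N) : ∃ p : Polynomial ℂ,
    p.natDegree < N ∧ ∀ t ∈ Set.Icc (-1:ℝ) 1,
      ‖expMap s t - p.eval (t : ℂ)‖ ≤ 4 * |s| ^ N / (2 ^ N * N.factorial) := by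
  obtain ⟨P, hP, hPt⟩ := exists_poly_cos_approx s 0 hN
  obtain ⟨Q, hQ, hQt⟩ := exists_poly_cos_approx s (-(Real.pi / 2)) hN
  refine ⟨P.map Complex.ofRealHom + Polynomial.C Complex.I * Q.map Complex.ofRealHom, ?_,
    fun t ht => ?_⟩
  · refine (Polynomial.natDegree_add_le _ _).trans_lt (max_lt ?_ ?_)
    · exact Polynomial.natDegree_map_le.trans_lt hP
    · exact ((Polynomial.natDegree_C_mul_le _ _).trans Polynomial.natDegree_map_le).trans_lt hQ
  · have h1 := hPt t ht
    have h2 := hQt t ht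
    rw [add_zero] at h1
    rw [← sub_eq_add_neg, Real.cos_sub_pi_div_two] at h2
    have he : ∀ R : Polynomial ℝ,
        (R.map Complex.ofRealHom).eval (t : ℂ) = ((R.eval t : ℝ) : ℂ) := fun R =>
      Polynomial.eval_map_apply Complex.ofRealHom t
    have h3 : expMap s t - (P.map Complex.ofRealHom +
        Polynomial.C Complex.I * Q.map Complex.ofRealHom).eval (t : ℂ) =
        ((Real.cos (s * t) - P.eval t : ℝ) : ℂ) +
          Complex.I * ((Real.sin (s * t) - Q.eval t : ℝ) : ℂ) := by
      rw [expMap_apply, Complex.exp_mul_I, Polynomial.eval_add, Polynomial.eval_mul,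
        Polynomial.eval_C, he, he, ← Complex.ofReal_cos, ← Complex.ofReal_sin]
      push_cast
      ring
    rw [h3]
    refine (norm_add_le _ _).trans ?_
    rw [norm_mul, Complex.norm_I, one_mul, Complex.norm_real, Complex.norm_real,
      Real.norm_eq_abs, Real.norm_eq_abs]
    refine (add_le_add h1 h2).trans_eq ?_
    field_simp
    ring

lemma integrableOn_mul_continuousMap {f : ℝ → ℝ} (hf : IntegrableOn f (Set.Ioo (-1:ℝ) 1))
    (φ : C(ℝ, ℂ)) : IntegrableOn (fun x => (f x : ℂ) * φ x) (Set.Ioo (-1:ℝ) 1) := by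
  have h : IntegrableOn (fun x => (f x : ℂ)) (Set.Ioo (-1:ℝ) 1) := hf.ofReal
  rw [← integrableOn_Icc_iff_integrableOn_Ioo] at h ⊢
  exact h.mul_continuousOn φ.continuous.continuousOn isCompact_Icc

/-- Integration against `f` over `(-1, 1)` as a linear functional on continuous functions. -/
noncomputable def integralAgainst {f : ℝ → ℝ} (hf : IntegrableOn f (Set.Ioo (-1:ℝ) 1)) :
    C(ℝ, ℂ) →ₗ[ℂ] ℂ where
  toFun φ := ∫ x in Set.Ioo (-1:ℝ) 1, (f x : ℂ) * φ x
  map_add' φ ψ := by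
    simp only [ContinuousMap.add_apply, mul_add]
    exact integral_add (integrableOn_mul_continuousMap hf φ) (integrableOn_mul_continuousMap hf ψ)
  map_smul' r φ := by
    simp only [ContinuousMap.smul_apply, smul_eq_mul, RingHom.id_apply, mul_left_comm _ r]
    exact integral_const_mul _ _

lemma integralAgainst_expMap {f : ℝ → ℝ} (hf : IntegrableOn f (Set.Ioo (-1:ℝ) 1)) (s : ℝ) :
    integralAgainst hf (expMap s) = fourierAt f s := rfl

lemma norm_integralAgainst_le {f : ℝ → ℝ} (hf : IntegrableOn f (Set.Ioo (-1:ℝ) 1)) {κ : ℝ}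
    (hκ : 0 < κ) (φ : C(ℝ, ℂ)) (K : ℝ)
    (hφ : ∀ t ∈ Set.Icc (-1:ℝ) 1, ‖φ t‖ ≤ K * Real.exp (κ * (t + 1))) :
    ‖integralAgainst hf φ‖ ≤ Real.exp (2 * κ) * (∫ x in Set.Ioo (-1:ℝ) 1, |f x|) * K := by
  have hK : 0 ≤ K := nonneg_of_mul_nonneg_left
    ((norm_nonneg _).trans (hφ 0 (by norm_num))) (Real.exp_pos _)
  have h : ‖integralAgainst hf φ‖ ≤
      ∫ x in Set.Ioo (-1:ℝ) 1, Real.exp (2 * κ) * K * |f x| := by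
    refine norm_integral_le_of_norm_le (hf.abs.const_mul _) ?_
    refine (ae_restrict_iff' measurableSet_Ioo).mpr (Filter.Eventually.of_forall fun x hx => ?_)
    rw [norm_mul, Complex.norm_real, Real.norm_eq_abs, mul_comm]
    gcongr
    refine (hφ x ⟨hx.1.le, hx.2.le⟩).trans ?_
    rw [mul_comm, mul_comm 2]
    gcongr
    linarith [hx.2]
  rw [integral_const_mul] at h
  refine h.trans_eq (by ring)

lemma norm_fourierAt_le_of_vanishing {f : ℝ → ℝ} (hf : IntegrableOn f (Set.Ioo (-1:ℝ) 1))
    {c δ s : ℝ} {N : ℕ} (hN : Even N) (hN0 : 0 < N) (hc : 0 < c) (hδ : 0 < δ)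
    (h0 : ∀ j < N, fourierAt f (c * chebNode N j) = 0) (hs : s ≠ 0) (hsc : |s| ≤ c) :
    ‖fourierAt f s‖ ≤ 8 * ((c / 4) ^ N / N.factorial) * (1 + δ) ^ N * Real.exp (2 * c / δ) *
      ∫ x in Set.Ioo (-1:ℝ) 1, |f x| := by
  obtain ⟨p, hp, happ⟩ := exists_poly_expMap_approx s hN0
  have hκ : 0 < c / δ := by positivity
  have h := norm_le_of_vanishing (ω := fun j => c * chebNode N j) (c := c) hκ
    (norm_integralAgainst_le hf hκ)
    (fun j _ => by
      rw [abs_mul, abs_of_pos hc]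
      exact mul_le_of_le_one_right hc.le (abs_chebNode_le_one N j))
    (fun i hi j hj he => hj.ne (injOn_chebNode N (by simpa using hj.trans hi) (by simpa using hi)
      (mul_left_cancel₀ hc.ne' he).symm))
    h0 (fun j hj => mul_ne_zero hc.ne' (chebNode_ne_zero hN hj)) (by positivity) p hp happ
  rw [integralAgainst_expMap, div_div_cancel₀ hc.ne'] at h
  have hprod : |∏ j ∈ Finset.range N, (s - c * chebNode N j)| ≤ c ^ N * (2 / 2 ^ N) := by
    have h1 : ∏ j ∈ Finset.range N, (s - c * chebNode N j) =
        c ^ N * ∏ j ∈ Finset.range N, (s / c - chebNode N j) := by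
      rw [← Finset.card_range N, ← Finset.prod_const, Finset.card_range, ← Finset.prod_mul_distrib]
      refine Finset.prod_congr rfl fun j _ => ?_
      field_simp
    rw [h1, abs_mul, abs_of_pos (pow_pos hc N)]
    gcongr
    refine abs_prod_sub_chebNode_le ?_
    rw [abs_div, abs_of_pos hc]
    exact (div_le_one hc).mpr hsc
  have hI : 0 ≤ ∫ x in Set.Ioo (-1:ℝ) 1, |f x| := integral_nonneg fun x => abs_nonneg _
  have hsN : 0 < |s| ^ N := pow_pos (abs_pos.mpr hs) N
  refine le_of_mul_le_mul_left (h.trans ((mul_le_mul_of_nonneg_right hprod ?_).trans_eq ?_)) hsN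
  · positivity
  · rw [div_pow, show (4:ℝ) ^ N = 2 ^ N * 2 ^ N by rw [← mul_pow]; norm_num, ← mul_div_assoc]
    field_simp
    ring

lemma fourierAt_neg {f : ℝ → ℝ} (s : ℝ) :
    fourierAt f (-s) = (starRingEnd ℂ) (fourierAt f s) := by
  unfold fourierAt
  rw [← integral_conj]
  refine integral_congr_ae (Filter.Eventually.of_forall fun x => ?_)
  simp only [map_mul, Complex.conj_ofReal, ← Complex.exp_conj, Complex.conj_I]
  push_cast
  ring_nf

lemma re_add_im_fourierAt {f : ℝ → ℝ} (hf : IntegrableOn f (Set.Ioo (-1:ℝ) 1)) (s : ℝ) :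
    (fourierAt f s).re + (fourierAt f s).im =
      ∫ x in Set.Ioo (-1:ℝ) 1, f x * (Real.cos (s * x) + Real.sin (s * x)) := by
  have h := (Complex.reCLM + Complex.imCLM).integral_comp_comm (integrable_mul_exp hf s)
  simp only [add_apply, Complex.reCLM_apply, Complex.imCLM_apply] at h
  unfold fourierAt
  rw [← h]
  refine integral_congr_ae (Filter.Eventually.of_forall fun x => ?_)
  simp only [Complex.re_ofReal_mul, Complex.im_ofReal_mul, Complex.exp_ofReal_mul_I_re,
    Complex.exp_ofReal_mul_I_im]
  ring

lemma exists_mem_fourierAt_eq_zero {N : ℕ} (c : ℝ)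
    (V : Submodule ℝ (Lp ℝ 2 (volume.restrict (Set.Ioo (-1:ℝ) 1))))
    (hV : N < Module.finrank ℝ V) :
    ∃ f ∈ V, f ≠ 0 ∧ ∀ j < N, fourierAt f (c * chebNode N j) = 0 := by
  have : Module.Finite ℝ V := Module.finite_of_finrank_pos (by omega)
  have hmem : ∀ s : ℝ, MemLp (fun x => Real.cos (s * x) + Real.sin (s * x)) 2
      (volume.restrict (Set.Ioo (-1:ℝ) 1)) := fun s => by
    refine MemLp.of_bound (Continuous.aestronglyMeasurable (by fun_prop)) 2
      (Filter.Eventually.of_forall fun x => ?_)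
    refine (abs_add_le _ _).trans ?_
    linarith [Real.abs_cos_le_one (s * x), Real.abs_sin_le_one (s * x)]
  obtain ⟨L, hL⟩ : ∃ L : V →ₗ[ℝ] (Fin N → ℝ), L = LinearMap.pi fun j : Fin N =>
      (innerₛₗ ℝ ((hmem (c * chebNode N j)).toLp _)).comp V.subtype := ⟨_, rfl⟩
  obtain ⟨f, hf, hf0⟩ := (Submodule.ne_bot_iff _).mp
    (L.ker_ne_bot_of_finrank_lt (by simpa using hV))
  have hint := integrableOn_of_Lp f.1
  have hsum : ∀ j < N, (fourierAt f.1 (c * chebNode N j)).re +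
      (fourierAt f.1 (c * chebNode N j)).im = 0 := fun j hj => by
    have h1 := congrFun (LinearMap.mem_ker.mp hf) ⟨j, hj⟩
    rw [hL] at h1
    simp only [LinearMap.pi_apply, LinearMap.comp_apply, innerₛₗ_apply_apply, Pi.zero_apply,
      Submodule.subtype_apply, L2.inner_def] at h1
    rw [re_add_im_fourierAt hint, ← h1]
    refine integral_congr_ae ?_
    filter_upwards [(hmem (c * chebNode N j)).coeFn_toLp] with x hx
    rw [hx]
    simp
  refine ⟨f.1, f.2, fun h => hf0 (Subtype.ext h), fun j hj => ?_⟩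
  have h1 := hsum j hj
  have h2 := hsum (N - 1 - j) (by omega)
  rw [chebNode_reflect hj, mul_neg, fourierAt_neg, Complex.conj_re, Complex.conj_im] at h2
  exact Complex.ext (by rw [Complex.zero_re]; linarith) (by rw [Complex.zero_im]; linarith)

lemma lambda_le_of_even {n N : ℕ} {c δ : ℝ} (hN : Even N) (hN0 : 0 < N) (hNn : N ≤ n) (hc : 0 < c)
    (hδ : 0 < δ) : lambda n c ≤ 2 * c *
      (8 * ((c / 4) ^ N / N.factorial) * (1 + δ) ^ N * Real.exp (2 * c / δ)) ^ 2 := by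
  refine lambda_le_of_forall hc.le (by positivity) fun V hV => ?_
  obtain ⟨f, hfV, hf0, hf⟩ := exists_mem_fourierAt_eq_zero (N := N) c V (by omega)
  refine ⟨f, hfV, hf0, ?_⟩
  obtain ⟨D, hD⟩ : ∃ D, D = 8 * ((c / 4) ^ N / N.factorial) * (1 + δ) ^ N *
    Real.exp (2 * c / δ) := ⟨_, rfl⟩
  rw [← hD]
  refine (QForm_le_of_fourierAt_le (K := D ^ 2 * (2 * ‖f‖ ^ 2)) hc.le f
    fun s hs hs0 => ?_).trans_eq (by ring)
  have h := norm_fourierAt_le_of_vanishing (integrableOn_of_Lp f) hN hN0 hc hδ hf hs0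
    (abs_le.mpr hs)
  rw [← hD] at h
  calc _ ≤ (D * ∫ x in Set.Ioo (-1:ℝ) 1, |f x|) ^ 2 := by gcongr
    _ = D ^ 2 * (∫ x in Set.Ioo (-1:ℝ) 1, |f x|) ^ 2 := mul_pow _ _ _
    _ ≤ _ := by gcongr; exact sq_integral_abs_le f

lemma lambda_le {n : ℕ} {c δ : ℝ} (hn : 2 ≤ n) (hc : 1 ≤ c) (hδ : 0 < δ) :
    lambda n c ≤ 2 * c *
      (32 * n * (Real.exp 1 * c / (4 * n)) ^ n * (1 + δ) ^ n * Real.exp (2 * c / δ)) ^ 2 := by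
  have hn0 : (0:ℝ) < n := by exact_mod_cast (by omega : 0 < n)
  have hn1 : (1:ℝ) ≤ n := by exact_mod_cast (by omega : 1 ≤ n)
  have hst : (c / 4) ^ n / n.factorial ≤ (Real.exp 1 * c / (4 * n)) ^ n := by
    have h := Real.pow_div_factorial_le_exp n hn0.le n
    rw [div_le_iff₀ (by positivity)] at h
    rw [div_le_iff₀ (by positivity), show Real.exp 1 * c / (4 * n) =
      Real.exp 1 / n * (c / 4) by field_simp, mul_pow, div_pow (Real.exp 1), ← Real.exp_nat_mul,
      mul_one]
    have h2 : 1 ≤ Real.exp n / n ^ n * n.factorial := by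
      rw [div_mul_eq_mul_div, le_div_iff₀ (by positivity), one_mul]
      exact h
    have h3 : 0 ≤ (c / 4) ^ n := by positivity
    nlinarith
  obtain ⟨N, hNe, hN0, hNn, hN⟩ : ∃ N, Even N ∧ 0 < N ∧ N ≤ n ∧
      (c / 4) ^ N / N.factorial ≤ 4 * n * ((c / 4) ^ n / n.factorial) := by
    rcases Nat.even_or_odd n with he | ⟨m, rfl⟩
    · refine ⟨n, he, by omega, le_rfl, le_mul_of_one_le_left (by positivity) (by linarith)⟩
    · refine ⟨2 * m, even_two_mul m, by omega, by omega, ?_⟩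
      rw [Nat.factorial_succ, Nat.cast_mul, pow_succ]
      field_simp
      exact hc
  refine (lambda_le_of_even hNe hN0 hNn (by linarith) hδ).trans ?_
  have h1 : (1 + δ) ^ N ≤ (1 + δ) ^ n := pow_le_pow_right₀ (by linarith) hNn
  have h2 : 8 * ((c / 4) ^ N / N.factorial) ≤ 32 * n * (Real.exp 1 * c / (4 * n)) ^ n := by
    calc _ ≤ 8 * (4 * n * ((c / 4) ^ n / n.factorial)) := by gcongr
      _ ≤ 8 * (4 * n * (Real.exp 1 * c / (4 * n)) ^ n) := by gcongr
      _ = _ := by ring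
  gcongr

lemma lambda_le_exp {a : ℝ} (ha : 0 < a) (ha' : a < 4 / Real.exp 1) :
    ∃ Ma : ℝ, ∀ c : ℝ, 1 ≤ c → ∀ n : ℕ, c * Ma ≤ (n:ℝ) →
      lambda n c ≤ Real.exp (-(2*(n:ℝ)) * Real.log (a*n/c)) := by
  have he : 0 < Real.exp 1 := Real.exp_pos 1
  rw [lt_div_iff₀ he] at ha'
  obtain ⟨t, ht, hta⟩ : ∃ t : ℝ, 1 < t ∧ a * Real.exp 1 * t ^ 3 = 4 := by
    refine ⟨(4 / (a * Real.exp 1)) ^ ((3:ℝ)⁻¹), Real.one_lt_rpow ?_ (by norm_num), ?_⟩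
    · rwa [one_lt_div (by positivity)]
    · rw [← Real.rpow_natCast, ← Real.rpow_mul (by positivity)]
      norm_num
      field_simp
  obtain ⟨N, hN⟩ := exists_forall_mul_pow_lt ht 2048 3
  have ht1 : 0 < t - 1 := by linarith
  have hlog : 0 < Real.log t := Real.log_pos ht
  refine ⟨2 + 2 / ((t - 1) * Real.log t) + N, fun c hc n hn => ?_⟩
  obtain ⟨M, hM⟩ : ∃ M, M = 2 + 2 / ((t - 1) * Real.log t) + (N:ℝ) := ⟨_, rfl⟩
  rw [← hM] at hn
  have hM2 : 2 ≤ M := by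
    have : 0 ≤ 2 / ((t - 1) * Real.log t) + (N:ℝ) := by positivity
    linarith
  have hMl : 2 ≤ M * ((t - 1) * Real.log t) := by
    rw [← div_le_iff₀ (by positivity)]
    have : (0:ℝ) ≤ N := by positivity
    linarith
  have hMN : (N:ℝ) ≤ M := by
    have : 0 ≤ 2 / ((t - 1) * Real.log t) := by positivity
    linarith
  have hMn : M ≤ n := by nlinarith
  have hcn : c ≤ n := by nlinarith
  have hc0 : 0 < c := by linarith
  have hn0 : (0:ℝ) < n := by linarith
  have hpow := hN n (by exact_mod_cast hMN.trans hMn)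
  have hexp : Real.exp (2 * c / (t - 1)) ≤ t ^ n := by
    rw [← Real.exp_log (by linarith : 0 < t), ← Real.exp_nat_mul, Real.exp_log (by linarith)]
    refine Real.exp_le_exp.mpr ?_
    rw [div_le_iff₀ ht1]
    calc 2 * c ≤ M * ((t - 1) * Real.log t) * c := by gcongr
      _ = c * M * ((t - 1) * Real.log t) := by ring
      _ ≤ n * ((t - 1) * Real.log t) := by gcongr
      _ = _ := by ring
  refine (lambda_le (by exact_mod_cast hM2.trans hMn) hc ht1).trans ?_
  obtain ⟨y, hy⟩ : ∃ y, y = a * n / c := ⟨_, rfl⟩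
  have hy0 : 0 < y := by rw [hy]; positivity
  have hbase : Real.exp 1 * c / (4 * n) = (y * t ^ 3)⁻¹ := by
    rw [hy]
    field_simp
    linarith
  rw [← hy, exp_neg_mul_log hy0, hbase, add_sub_cancel]
  have htn : 1 ≤ t ^ n := one_le_pow₀ ht.le
  calc 2 * c * (32 * n * (y * t ^ 3)⁻¹ ^ n * t ^ n * Real.exp (2 * c / (t - 1))) ^ 2
      ≤ 2 * n * (32 * n * (y * t ^ 3)⁻¹ ^ n * t ^ n * t ^ n) ^ 2 := by gcongr
    _ = 2048 * (n:ℝ) ^ 3 * ((t ^ n) ^ 2)⁻¹ * (y ^ (2 * n))⁻¹ := by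
      rw [inv_pow, show (y * t ^ 3) ^ n = y ^ n * (t ^ n * t ^ n * t ^ n) by ring,
        show y ^ (2 * n) = y ^ n * y ^ n by ring]
      generalize t ^ n = u at htn ⊢
      have hu : u ≠ 0 := by linarith
      field_simp
      norm_num
    _ ≤ 1 * (y ^ (2 * n))⁻¹ := by
      gcongr
      rw [← div_eq_mul_inv, div_le_one (by positivity)]
      nlinarith
    _ = _ := one_mul _

theorem stmt4 :
    (∀ a : ℝ, 0 < a → a < 4 / Real.exp 1 →
      ∃ Ma : ℝ, ∀ c : ℝ, 1 ≤ c → ∀ n : ℕ, c * Ma ≤ (n:ℝ) →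
        lambda n c ≤ Real.exp (-(2*(n:ℝ)) * Real.log (a*n/c))) ∧
    (∀ b : ℝ, 4 / Real.exp 1 < b →
      ∃ Mb : ℝ, ∀ c : ℝ, 1 ≤ c → ∀ n : ℕ, c * Mb ≤ (n:ℝ) →
        Real.exp (-(2*(n:ℝ)) * Real.log (b*n/c)) < lambda n c) :=
  ⟨fun _ ha ha' => lambda_le_exp ha ha', fun _ hb => exp_lt_lambda hb⟩
end

section
/- For every integer n ≥ 0 and every real c with 0 < c < π(n + 1/2)/2, one has (1/2) · ( e·c/(4(n + 1/2)) )^{2n+1} · e^{−π²c²/(4(n + 1/2))} ≤ λ̃_n(c) ≤ (1/2) · ( e·c/(4(n + 1/2)) )^{2n+1} · e^{π²c²/(4(n + 1/2))}. -/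
open MeasureTheory

open Set Filter Topology Real

/-- Differentiation under an interval integral whose integrand is differentiable in the parameter
with jointly continuous derivative. -/
theorem hasDerivAt_intervalIntegral_of_continuousOn {F F' : ℝ → ℝ → ℝ} {U : Set ℝ} {a b x₀ : ℝ}
    (hU : IsOpen U) (hF : ∀ x ∈ U, Continuous (F x))
    (hF' : ContinuousOn (Function.uncurry F') (U ×ˢ univ))
    (hd : ∀ x ∈ U, ∀ t, HasDerivAt (fun y => F y t) (F' x t) x) (hx : x₀ ∈ U) :
    HasDerivAt (fun x => ∫ t in a..b, F x t) (∫ t in a..b, F' x₀ t) x₀ := by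
  obtain ⟨ε, hε, hball⟩ := Metric.nhds_basis_closedBall.mem_iff.1 (hU.mem_nhds hx)
  have hK : IsCompact (Metric.closedBall x₀ ε ×ˢ uIcc a b) :=
    (isCompact_closedBall x₀ ε).prod isCompact_uIcc
  obtain ⟨C, hC⟩ := hK.exists_bound_of_continuousOn
    (hF'.mono (prod_mono hball (subset_univ _)))
  have hF'x : Continuous (F' x₀) := by
    rw [← continuousOn_univ]
    exact hF'.comp (f := fun t => (x₀, t)) (by fun_prop) (fun t _ => ⟨hx, mem_univ t⟩)
  refine (intervalIntegral.hasDerivAt_integral_of_dominated_loc_of_deriv_le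
    (F := F) (F' := F') (bound := fun _ => C)
    (Metric.closedBall_mem_nhds x₀ hε) ?_ ((hF x₀ hx).intervalIntegrable _ _)
    hF'x.aestronglyMeasurable ?_ (by simp) ?_).2
  · filter_upwards [hU.mem_nhds hx] with x hx
    exact (hF x hx).aestronglyMeasurable
  · exact ae_of_all _ fun t ht x hx => hC (x, t) ⟨hx, uIoc_subset_uIcc ht⟩
  · exact ae_of_all _ fun t _ x hx => hd x (hball hx) t

/-- The complete elliptic integral of the second kind in trigonometric form, as a function of the
parameter `m = k ^ 2`. -/
noncomputable def ellA (m : ℝ) : ℝ := ∫ θ in (0 : ℝ)..π / 2, √(1 - m * sin θ ^ 2)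

/-- The difference `K - E` of the complete elliptic integrals of the first and second kind, as a
function of the parameter `m = k ^ 2`. -/
noncomputable def ellB (m : ℝ) : ℝ :=
  ∫ θ in (0 : ℝ)..π / 2, m * sin θ ^ 2 / √(1 - m * sin θ ^ 2)

theorem one_sub_mul_sin_sq_pos {m : ℝ} (hm : m < 1) (θ : ℝ) : 0 < 1 - m * sin θ ^ 2 := by
  rcases le_or_gt m 0 with h | h
  · nlinarith [sq_nonneg (sin θ)]
  · nlinarith [sin_sq_le_one θ]

theorem ellE_eq_ellA (k : ℝ) : ellE k = ellA (k ^ 2) := by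
  have himg : sin '' Ioo 0 (π / 2) = Ioo 0 1 := by
    ext x
    constructor
    · rintro ⟨θ, hθ, rfl⟩
      refine ⟨sin_pos_of_pos_of_lt_pi hθ.1 (by linarith [hθ.2, pi_pos]), ?_⟩
      rw [← sin_pi_div_two]
      exact sin_lt_sin_of_lt_of_le_pi_div_two (by linarith [hθ.1, pi_pos]) le_rfl hθ.2
    · rintro ⟨h0, h1⟩
      exact ⟨arcsin x, ⟨arcsin_pos.2 h0, arcsin_lt_pi_div_two.2 h1⟩,
        sin_arcsin (by linarith) h1.le⟩
  have hinj : InjOn sin (Ioo 0 (π / 2)) :=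
    injOn_sin.mono (Ioo_subset_Icc_self.trans (Icc_subset_Icc_left (by linarith [pi_pos])))
  rw [ellE, ellA, intervalIntegral.integral_of_le zero_le_one,
    intervalIntegral.integral_of_le (by positivity), integral_Ioc_eq_integral_Ioo,
    integral_Ioc_eq_integral_Ioo, ← himg,
    integral_image_eq_integral_abs_deriv_smul measurableSet_Ioo
      (fun θ _ => (hasDerivAt_sin θ).hasDerivWithinAt) hinj]
  refine setIntegral_congr_fun measurableSet_Ioo fun θ hθ => ?_
  have hcos : 0 < cos θ := cos_pos_of_mem_Ioo ⟨by linarith [hθ.1, pi_pos], hθ.2⟩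
  simp only [smul_eq_mul]
  rw [← cos_sq', sqrt_div' _ (sq_nonneg _), sqrt_sq hcos.le, abs_of_pos hcos]
  field_simp

theorem continuous_ellA : Continuous ellA :=
  intervalIntegral.continuous_parametric_intervalIntegral_of_continuous'
    (by simp only [Function.uncurry_def]; fun_prop) _ _

theorem continuous_ellB_integrand {m : ℝ} (hm : m < 1) :
    Continuous fun θ => m * sin θ ^ 2 / √(1 - m * sin θ ^ 2) := by
  refine Continuous.div (by fun_prop) (by fun_prop) fun θ => ?_
  exact (sqrt_pos.2 (one_sub_mul_sin_sq_pos hm θ)).ne'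

theorem ellA_zero : ellA 0 = π / 2 := by simp [ellA]

theorem ellA_one : ellA 1 = 1 := by
  have : ellA 1 = ∫ θ in (0 : ℝ)..π / 2, cos θ := by
    refine intervalIntegral.integral_congr fun θ hθ => ?_
    rw [uIcc_of_le (by positivity)] at hθ
    have hcos : 0 ≤ cos θ :=
      cos_nonneg_of_neg_pi_div_two_le_of_le (by linarith [hθ.1, pi_pos]) hθ.2
    simp only [one_mul]
    rw [← cos_sq', sqrt_sq hcos]
  rw [this]
  simp

theorem ellA_antitone : Antitone ellA := by
  intro m m' h
  refine intervalIntegral.integral_mono_on (by positivity)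
    (Continuous.intervalIntegrable (by fun_prop) _ _)
    (Continuous.intervalIntegrable (by fun_prop) _ _) fun θ _ => ?_
  gcongr

theorem one_le_ellA {m : ℝ} (hm : m ≤ 1) : 1 ≤ ellA m := ellA_one ▸ ellA_antitone hm

theorem ellA_le {m : ℝ} (hm : 0 ≤ m) : ellA m ≤ π / 2 := ellA_zero ▸ ellA_antitone hm

theorem pi_div_two_sub_ellA_le {m : ℝ} (hm0 : 0 ≤ m) (hm : m ≤ 1) : π / 2 - ellA m ≤ m * (π / 4) := by
  have h : ∫ θ in (0 : ℝ)..π / 2, (1 - m * sin θ ^ 2) ≤ ellA m := by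
    refine intervalIntegral.integral_mono_on (by positivity)
      (Continuous.intervalIntegrable (by fun_prop) _ _)
      (Continuous.intervalIntegrable (by fun_prop) _ _) fun θ _ => ?_
    have h0 : 0 ≤ 1 - m * sin θ ^ 2 := by nlinarith [sin_sq_le_one θ, sq_nonneg (sin θ)]
    refine le_sqrt_of_sq_le ?_
    nlinarith [mul_nonneg hm0 (sq_nonneg (sin θ))]
  rw [intervalIntegral.integral_sub (by simp) (Continuous.intervalIntegrable (by fun_prop) _ _),
    intervalIntegral.integral_const_mul, integral_sin_sq] at h
  simp at h
  linarith

theorem ellB_nonneg {m : ℝ} (hm : 0 ≤ m) : 0 ≤ ellB m :=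
  intervalIntegral.integral_nonneg (by positivity) fun θ _ => by positivity

theorem ellB_le {m : ℝ} (hm : 0 ≤ m) (hm1 : m < 1) : ellB m ≤ m * (π / 2) / √(1 - m) := by
  have h : ellB m ≤ ∫ θ in (0 : ℝ)..π / 2, m / √(1 - m) := by
    refine intervalIntegral.integral_mono_on (by positivity)
      ((continuous_ellB_integrand hm1).intervalIntegrable _ _) (by simp) fun θ _ => ?_
    have h1 : 0 < √(1 - m) := sqrt_pos.2 (by linarith)
    have := sin_sq_le_one θ
    gcongr
    · nlinarith [sq_nonneg (sin θ)]
    · nlinarith [sq_nonneg (sin θ)]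
  refine h.trans (le_of_eq ?_)
  simp
  ring

theorem ellB_le_mul_add {m : ℝ} (hm : 0 ≤ m) (hm1 : m < 1) : ellB m ≤ m * (ellA m + ellB m) := by
  have hA : IntervalIntegrable (fun θ => √(1 - m * sin θ ^ 2)) volume 0 (π / 2) :=
    Continuous.intervalIntegrable (by fun_prop) _ _
  have hB := (continuous_ellB_integrand hm1).intervalIntegrable (μ := volume) 0 (π / 2)
  have : m * (ellA m + ellB m) = ∫ θ in (0 : ℝ)..π / 2,
      m * (√(1 - m * sin θ ^ 2) + m * sin θ ^ 2 / √(1 - m * sin θ ^ 2)) := by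
    rw [intervalIntegral.integral_const_mul, intervalIntegral.integral_add hA hB, ellA, ellB]
  rw [this]
  refine intervalIntegral.integral_mono_on (by positivity) hB ((hA.add hB).const_mul m) fun θ _ => ?_
  have hp := one_sub_mul_sin_sq_pos hm1 θ
  have hs := sqrt_pos.2 hp
  rw [div_le_iff₀ hs, mul_assoc, add_mul, div_mul_cancel₀ _ hs.ne', mul_self_sqrt hp.le]
  nlinarith [sin_sq_le_one θ]

theorem hasDerivAt_sqrt_one_sub_mul {m : ℝ} (hm : m < 1) (θ : ℝ) :
    HasDerivAt (fun y => √(1 - y * sin θ ^ 2))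
      (-(sin θ ^ 2 / (2 * √(1 - m * sin θ ^ 2)))) m := by
  have h := (((hasDerivAt_id m).mul_const (sin θ ^ 2)).const_sub 1).sqrt
    (one_sub_mul_sin_sq_pos hm θ).ne'
  simp only [id, one_mul] at h
  rwa [neg_div] at h

theorem sqrt_one_sub_mul_sin_sq_ne_zero :
    ∀ p ∈ Iio (1 : ℝ) ×ˢ (univ : Set ℝ), √(1 - p.1 * sin p.2 ^ 2) ≠ 0 := fun p hp =>
  (sqrt_pos.2 (one_sub_mul_sin_sq_pos hp.1 p.2)).ne'

theorem hasDerivAt_ellA {m : ℝ} (hm0 : m ≠ 0) (hm : m < 1) :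
    HasDerivAt ellA (-ellB m / (2 * m)) m := by
  have h := hasDerivAt_intervalIntegral_of_continuousOn (a := 0) (b := π / 2)
    (F := fun y θ => √(1 - y * sin θ ^ 2))
    (F' := fun y θ => -(sin θ ^ 2 / (2 * √(1 - y * sin θ ^ 2)))) (U := Iio 1) isOpen_Iio
    (fun x _ => by fun_prop)
    (by
      simp only [Function.uncurry_def]
      refine ContinuousOn.neg (ContinuousOn.div (by fun_prop) (by fun_prop) fun p hp => ?_)
      exact mul_ne_zero two_ne_zero (sqrt_one_sub_mul_sin_sq_ne_zero p hp))
    (fun x hx θ => hasDerivAt_sqrt_one_sub_mul hx θ) hm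
  change HasDerivAt (fun y => ∫ θ in (0 : ℝ)..π / 2, √(1 - y * sin θ ^ 2)) _ m
  convert h using 1
  rw [ellB, neg_div, div_eq_inv_mul, ← intervalIntegral.integral_const_mul,
    ← intervalIntegral.integral_neg]
  refine intervalIntegral.integral_congr fun θ _ => ?_
  have := (sqrt_pos.2 (one_sub_mul_sin_sq_pos hm θ)).ne'
  field_simp

theorem sqrt_primitive_identity {m s c q : ℝ} (hq : q ≠ 0) (hm : 1 - m ≠ 0)
    (hq2 : q ^ 2 = 1 - m * s ^ 2) (hc : c ^ 2 = 1 - s ^ 2) :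
    s ^ 2 / q + m * s ^ 4 / (2 * q ^ 3) - q / (2 * (1 - m)) =
      -(((c * c + s * -s) * q - s * c * (-(m * (2 * s * c)) / (2 * q))) / q ^ 2)
        / (2 * (1 - m)) := by
  field_simp
  have hq4 : (q ^ 2) ^ 2 = q ^ 4 := by ring
  simp only [hq2, hc, ← hq4]
  ring

theorem hasDerivAt_ellB {m : ℝ} (hm : m < 1) :
    HasDerivAt ellB (ellA m / (2 * (1 - m))) m := by
  have h := hasDerivAt_intervalIntegral_of_continuousOn (a := 0) (b := π / 2)
    (F := fun y θ => y * sin θ ^ 2 / √(1 - y * sin θ ^ 2))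
    (F' := fun y θ => sin θ ^ 2 / √(1 - y * sin θ ^ 2)
      + y * sin θ ^ 4 / (2 * √(1 - y * sin θ ^ 2) ^ 3)) (U := Iio 1) isOpen_Iio
    (fun x hx => continuous_ellB_integrand hx)
    (by
      simp only [Function.uncurry_def]
      refine ContinuousOn.add (ContinuousOn.div (by fun_prop) (by fun_prop) ?_)
        (ContinuousOn.div (by fun_prop) (by fun_prop) fun p hp => ?_)
      · exact sqrt_one_sub_mul_sin_sq_ne_zero
      · exact mul_ne_zero two_ne_zero (pow_ne_zero 3 (sqrt_one_sub_mul_sin_sq_ne_zero p hp)))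
    (fun x hx θ => by
      have hne := (sqrt_pos.2 (one_sub_mul_sin_sq_pos hx θ)).ne'
      refine (((hasDerivAt_id x).mul_const (sin θ ^ 2)).fun_div
        (hasDerivAt_sqrt_one_sub_mul hx θ) hne).congr_deriv ?_
      simp only [id_eq, one_mul]
      field_simp
      ring) hm
  change HasDerivAt (fun y => ∫ θ in (0 : ℝ)..π / 2, y * sin θ ^ 2 / √(1 - y * sin θ ^ 2)) _ m
  convert h using 1
  have hpos := one_sub_mul_sin_sq_pos hm
  have hspos := fun θ => sqrt_pos.2 (hpos θ)
  have hm' : 1 - m ≠ 0 := (sub_pos.2 hm).ne'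
  have hprim : ∀ θ, HasDerivAt (fun θ => -(sin θ * cos θ / √(1 - m * sin θ ^ 2)) / (2 * (1 - m)))
      (sin θ ^ 2 / √(1 - m * sin θ ^ 2) + m * sin θ ^ 4 / (2 * √(1 - m * sin θ ^ 2) ^ 3)
        - √(1 - m * sin θ ^ 2) / (2 * (1 - m))) θ := by
    intro θ
    have h1 : HasDerivAt (fun θ => √(1 - m * sin θ ^ 2))
        (-(m * (2 * sin θ * cos θ)) / (2 * √(1 - m * sin θ ^ 2))) θ := by
      have := ((((hasDerivAt_sin θ).fun_pow 2).const_mul m).const_sub 1).sqrt (hpos θ).ne'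
      simpa using this
    refine ((((hasDerivAt_sin θ).fun_mul (hasDerivAt_cos θ)).fun_div h1
      (hspos θ).ne').fun_neg.div_const (2 * (1 - m))).congr_deriv ?_
    exact (sqrt_primitive_identity (hspos θ).ne' hm' (sq_sqrt (hpos θ).le) (cos_sq' θ)).symm
  have hAint : IntervalIntegrable (fun θ => √(1 - m * sin θ ^ 2) / (2 * (1 - m))) volume 0 (π / 2) :=
    Continuous.intervalIntegrable (by fun_prop) _ _
  have hc : Continuous fun θ => sin θ ^ 2 / √(1 - m * sin θ ^ 2)
      + m * sin θ ^ 4 / (2 * √(1 - m * sin θ ^ 2) ^ 3) := by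
    refine (Continuous.div (by fun_prop) (by fun_prop) fun θ => (hspos θ).ne').add
      (Continuous.div (by fun_prop) (by fun_prop) fun θ => ?_)
    exact mul_ne_zero two_ne_zero (pow_ne_zero 3 (hspos θ).ne')
  have hFTC := intervalIntegral.integral_eq_sub_of_hasDerivAt (a := 0) (b := π / 2)
    (fun θ _ => hprim θ) ((hc.intervalIntegrable _ _).sub hAint)
  rw [intervalIntegral.integral_sub (hc.intervalIntegrable _ _) hAint,
    intervalIntegral.integral_div] at hFTC
  simp only [sin_pi_div_two, cos_pi_div_two, sin_zero, cos_zero] at hFTC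
  simp only [mul_zero, zero_mul, zero_div, neg_zero, sub_zero] at hFTC
  rw [ellA]
  linarith

/-- Legendre's relation. -/
theorem ellA_mul_sub_ellB_mul {m : ℝ} (hm0 : 0 < m) (hm : m < 1) :
    ellA m * ellA (1 - m) - ellB m * ellB (1 - m) = π / 2 := by
  set L : ℝ → ℝ := fun m => ellA m * ellA (1 - m) - ellB m * ellB (1 - m) with hL
  have hd : ∀ x ∈ Ioo (0 : ℝ) 1, HasDerivAt L 0 x := by
    rintro x ⟨h0, h1⟩
    have hx0 : x ≠ 0 := h0.ne'
    have hx1 : 1 - x ≠ 0 := (sub_pos.2 h1).ne'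
    have hid : HasDerivAt (fun y : ℝ => 1 - y) (-1) x := (hasDerivAt_id x).const_sub 1
    have hA1 := (hasDerivAt_ellA hx1 (by linarith)).comp x hid
    have hB1 := (hasDerivAt_ellB (m := 1 - x) (by linarith)).comp x hid
    refine (((hasDerivAt_ellA hx0 h1).fun_mul hA1).fun_sub
      ((hasDerivAt_ellB h1).fun_mul hB1)).congr_deriv ?_
    simp only [Function.comp_apply, sub_sub_cancel]
    field_simp
    ring
  have hconst : ∀ x ∈ Ioo (0 : ℝ) 1, L x = L m := fun x hx =>
    isOpen_Ioo.is_const_of_deriv_eq_zero isPreconnected_Ioo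
      (fun y hy => (hd y hy).differentiableAt.differentiableWithinAt)
      (fun y hy => (hd y hy).deriv) hx ⟨hm0, hm⟩
  have hev : ∀ᶠ x : ℝ in 𝓝[>] 0, x ∈ Ioo (0 : ℝ) 1 := Ioo_mem_nhdsGT one_pos
  have hlim : Tendsto L (𝓝[>] 0) (𝓝 (π / 2)) := by
    have h1 : Tendsto (fun x => ellA x * ellA (1 - x)) (𝓝[>] 0) (𝓝 (π / 2)) := by
      have hc : Continuous fun x => ellA x * ellA (1 - x) :=
        continuous_ellA.mul (continuous_ellA.comp (by fun_prop))
      have := (hc.tendsto 0).mono_left (nhdsWithin_le_nhds (s := Ioi 0))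
      simpa [ellA_zero, ellA_one] using this
    have h2 : Tendsto (fun x => ellB x * ellB (1 - x)) (𝓝[>] 0) (𝓝 0) := by
      have hb : Tendsto (fun x : ℝ => √x * √(1 - x) * (π / 2) ^ 2) (𝓝[>] 0) (𝓝 0) := by
        have hc : Continuous fun x : ℝ => √x * √(1 - x) * (π / 2) ^ 2 := by fun_prop
        have := (hc.tendsto 0).mono_left (nhdsWithin_le_nhds (s := Ioi 0))
        simpa using this
      refine squeeze_zero' ?_ ?_ hb
      · filter_upwards [hev] with x hx
        exact mul_nonneg (ellB_nonneg hx.1.le) (ellB_nonneg (by linarith [hx.2]))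
      · filter_upwards [hev] with x hx
        have hx1 : 0 < 1 - x := sub_pos.2 hx.2
        have e1 := ellB_le hx.1.le hx.2
        have e2 := ellB_le hx1.le (by linarith [hx.1])
        rw [sub_sub_cancel] at e2
        refine (mul_le_mul e1 e2 (ellB_nonneg hx1.le)
          ((ellB_nonneg hx.1.le).trans e1)).trans (le_of_eq ?_)
        have s1 := sqrt_pos.2 hx.1
        have s2 := sqrt_pos.2 hx1
        have q1 := sq_sqrt hx.1.le
        have q2 := sq_sqrt hx1.le
        field_simp
        rw [q1, q2, mul_comm]
    simpa using h1.sub h2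
  have hlim' : Tendsto L (𝓝[>] 0) (𝓝 (L m)) :=
    tendsto_const_nhds.congr' (by filter_upwards [hev] with x hx using (hconst x hx).symm)
  exact tendsto_nhds_unique hlim' hlim

theorem ellB_one_sub_eq {m : ℝ} (hm0 : 0 < m) (hm : m < 1) :
    ellB (1 - m) = √(1 - m) * log ((1 + √(1 - m)) / √m) -
      (1 - m) * ∫ θ in (0 : ℝ)..π / 2, sin θ * (1 - sin θ) / √(cos θ ^ 2 + m * sin θ ^ 2) := by
  have hq : ∀ θ, 1 - (1 - m) * sin θ ^ 2 = cos θ ^ 2 + m * sin θ ^ 2 := fun θ => by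
    rw [cos_sq']; ring
  have hpos : ∀ θ, 0 < cos θ ^ 2 + m * sin θ ^ 2 := fun θ =>
    hq θ ▸ one_sub_mul_sin_sq_pos (by linarith) θ
  have hspos : ∀ θ, 0 < √(cos θ ^ 2 + m * sin θ ^ 2) := fun θ => sqrt_pos.2 (hpos θ)
  have ha : 0 < √(1 - m) := sqrt_pos.2 (sub_pos.2 hm)
  have hb : 0 < √m := sqrt_pos.2 hm0
  have ha2 : √(1 - m) ^ 2 = 1 - m := sq_sqrt (sub_pos.2 hm).le
  have hb2 : √m ^ 2 = m := sq_sqrt hm0.le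
  have hc1 : Continuous fun θ => sin θ / √(cos θ ^ 2 + m * sin θ ^ 2) :=
    Continuous.div (by fun_prop) (by fun_prop) fun θ => (hspos θ).ne'
  have hc2 : Continuous fun θ => sin θ * (1 - sin θ) / √(cos θ ^ 2 + m * sin θ ^ 2) :=
    Continuous.div (by fun_prop) (by fun_prop) fun θ => (hspos θ).ne'
  have hprim : ∀ θ, HasDerivAt (fun θ => -(arsinh (√(1 - m) * cos θ / √m) / √(1 - m)))
      (sin θ / √(cos θ ^ 2 + m * sin θ ^ 2)) θ := by
    intro θ
    refine (((((hasDerivAt_cos θ).const_mul (√(1 - m))).div_const (√m)).arsinh).div_const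
      (√(1 - m))).fun_neg.congr_deriv ?_
    have : 1 + (√(1 - m) * cos θ / √m) ^ 2 = (cos θ ^ 2 + m * sin θ ^ 2) / m := by
      rw [div_pow, mul_pow, ha2, hb2, sin_sq]
      field_simp
      ring
    rw [this, sqrt_div (hpos θ).le]
    have := (hspos θ).ne'
    simp only [smul_eq_mul]
    field_simp
  have hI : ∫ θ in (0 : ℝ)..π / 2, sin θ / √(cos θ ^ 2 + m * sin θ ^ 2) =
      log ((1 + √(1 - m)) / √m) / √(1 - m) := by
    rw [intervalIntegral.integral_eq_sub_of_hasDerivAt (fun θ _ => hprim θ)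
      (hc1.intervalIntegrable _ _)]
    simp only [cos_pi_div_two, cos_zero, mul_zero, zero_div, arsinh_zero, neg_zero, zero_sub,
      neg_neg, mul_one]
    have : 1 + (√(1 - m) / √m) ^ 2 = 1 / m := by
      rw [div_pow, ha2, hb2]; field_simp; ring
    rw [arsinh, this, sqrt_div zero_le_one, sqrt_one, ← add_div, add_comm]
  have hsplit : ellB (1 - m) = (1 - m) *
      ((∫ θ in (0 : ℝ)..π / 2, sin θ / √(cos θ ^ 2 + m * sin θ ^ 2)) -
        ∫ θ in (0 : ℝ)..π / 2, sin θ * (1 - sin θ) / √(cos θ ^ 2 + m * sin θ ^ 2)) := by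
    rw [← intervalIntegral.integral_sub (hc1.intervalIntegrable _ _) (hc2.intervalIntegrable _ _),
      ← intervalIntegral.integral_const_mul, ellB]
    refine intervalIntegral.integral_congr fun θ _ => ?_
    have := (hspos θ).ne'
    simp only [hq]
    field_simp
    ring
  rw [hsplit, hI, mul_sub]
  congr 1
  field_simp
  rw [ha2]

theorem tendsto_integral_ellB_remainder :
    Tendsto (fun m : ℝ => ∫ θ in (0 : ℝ)..π / 2,
      sin θ * (1 - sin θ) / √(cos θ ^ 2 + m * sin θ ^ 2)) (𝓝[>] 0) (𝓝 (1 - log 2)) := by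
  have hval : ∫ θ in (0 : ℝ)..π / 2, sin θ * cos θ / (1 + sin θ) = 1 - log 2 := by
    have hs : ∀ θ ∈ uIcc (0 : ℝ) (π / 2), 0 < 1 + sin θ := fun θ hθ => by
      rw [uIcc_of_le (by positivity)] at hθ
      linarith [sin_nonneg_of_nonneg_of_le_pi hθ.1 (by linarith [hθ.2, pi_pos])]
    have hd : ∀ θ ∈ uIcc (0 : ℝ) (π / 2), HasDerivAt (fun θ => sin θ - log (1 + sin θ))
        (sin θ * cos θ / (1 + sin θ)) θ := fun θ hθ => by
      refine ((hasDerivAt_sin θ).fun_sub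
        (((hasDerivAt_sin θ).const_add 1).log (hs θ hθ).ne')).congr_deriv ?_
      have := (hs θ hθ).ne'
      field_simp
      ring
    rw [intervalIntegral.integral_eq_sub_of_hasDerivAt hd
      (ContinuousOn.intervalIntegrable (ContinuousOn.div (by fun_prop) (by fun_prop)
        fun θ hθ => (hs θ hθ).ne'))]
    norm_num
  rw [← hval]
  have hfac : ∀ θ ∈ Ioo (0 : ℝ) (π / 2), 0 < sin θ ∧ 0 < cos θ ∧
      sin θ * (1 - sin θ) / √(cos θ ^ 2) = sin θ * cos θ / (1 + sin θ) := by
    intro θ hθ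
    have h1 : 0 < sin θ := sin_pos_of_pos_of_lt_pi hθ.1 (by linarith [hθ.2, pi_pos])
    have h2 : 0 < cos θ := cos_pos_of_mem_Ioo ⟨by linarith [hθ.1, pi_pos], hθ.2⟩
    refine ⟨h1, h2, ?_⟩
    rw [sqrt_sq h2.le, div_eq_div_iff h2.ne' (by linarith)]
    linear_combination (-sin θ) * sin_sq_add_cos_sq θ
  have hae : ∀ᵐ θ : ℝ, θ ∈ uIoc (0 : ℝ) (π / 2) → θ ∈ Ioo (0 : ℝ) (π / 2) := by
    have : ∀ᵐ θ : ℝ, θ ≠ π / 2 := by simp [ae_iff]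
    filter_upwards [this] with θ hne hθ
    rw [uIoc_of_le (by positivity)] at hθ
    exact ⟨hθ.1, lt_of_le_of_ne hθ.2 hne⟩
  refine intervalIntegral.tendsto_integral_filter_of_dominated_convergence (fun _ => 1) ?_ ?_
    (by simp) ?_
  · exact Eventually.of_forall fun m => Measurable.aestronglyMeasurable (by fun_prop)
  · filter_upwards [self_mem_nhdsWithin] with m hm
    filter_upwards [hae] with θ h hθ
    obtain ⟨h1, h2, h3⟩ := hfac θ (h hθ)
    have hm : 0 < m := hm
    have hs := sin_le_one θ
    rw [norm_of_nonneg (div_nonneg (mul_nonneg h1.le (by linarith)) (sqrt_nonneg _))]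
    calc sin θ * (1 - sin θ) / √(cos θ ^ 2 + m * sin θ ^ 2)
        ≤ sin θ * (1 - sin θ) / √(cos θ ^ 2) := by
          have : 0 < √(cos θ ^ 2) := sqrt_pos.2 (by positivity)
          refine div_le_div_of_nonneg_left (mul_nonneg h1.le (by linarith)) this ?_
          exact sqrt_le_sqrt (by nlinarith [sq_nonneg (sin θ)])
      _ = sin θ * cos θ / (1 + sin θ) := h3
      _ ≤ 1 := by
          rw [div_le_one (by linarith)]
          nlinarith [cos_le_one θ]
  · filter_upwards [hae] with θ h hθ
    obtain ⟨h1, h2, h3⟩ := hfac θ (h hθ)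
    rw [← h3]
    have hc : Tendsto (fun m : ℝ => √(cos θ ^ 2 + m * sin θ ^ 2)) (𝓝[>] 0) (𝓝 √(cos θ ^ 2)) := by
      have hc : Continuous fun m : ℝ => √(cos θ ^ 2 + m * sin θ ^ 2) := by fun_prop
      have := (hc.tendsto 0).mono_left (nhdsWithin_le_nhds (s := Ioi 0))
      simpa using this
    exact tendsto_const_nhds.div hc (sqrt_pos.2 (by positivity)).ne'

theorem tendsto_ellB_one_sub_add_log :
    Tendsto (fun m => ellB (1 - m) + log m / 2) (𝓝[>] 0) (𝓝 (2 * log 2 - 1)) := by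
  have hcont : ∀ f : ℝ → ℝ, Continuous f → Tendsto f (𝓝[>] 0) (𝓝 (f 0)) := fun f hf =>
    (hf.tendsto 0).mono_left nhdsWithin_le_nhds
  have h1 : Tendsto (fun m => √(1 - m) * log (1 + √(1 - m))) (𝓝[>] 0) (𝓝 (log 2)) := by
    have := hcont (fun m => √(1 - m) * log (1 + √(1 - m)))
      (Continuous.mul (by fun_prop) (Continuous.log (by fun_prop)
        fun m => by have := sqrt_nonneg (1 - m); linarith))
    norm_num at this
    exact this
  have h2 : Tendsto (fun m => (1 - m) * ∫ θ in (0 : ℝ)..π / 2,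
      sin θ * (1 - sin θ) / √(cos θ ^ 2 + m * sin θ ^ 2)) (𝓝[>] 0) (𝓝 (1 - log 2)) := by
    have := (hcont (fun m => 1 - m) (by fun_prop)).mul tendsto_integral_ellB_remainder
    simpa using this
  have h3 : Tendsto (fun m => (m * log m) * (1 / (2 * (1 + √(1 - m))))) (𝓝[>] 0) (𝓝 0) := by
    have e1 : Tendsto (fun m => m * log m) (𝓝[>] 0) (𝓝 0) := by
      have := hcont _ continuous_mul_log
      simpa using this
    have e2 := hcont (fun m => 1 / (2 * (1 + √(1 - m))))
      (Continuous.div (by fun_prop) (by fun_prop)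
        fun m => by have := sqrt_nonneg (1 - m); positivity)
    simpa using e1.mul e2
  have h := (h1.sub h2).add h3
  have hval : log 2 - (1 - log 2) + 0 = 2 * log 2 - 1 := by ring
  rw [hval] at h
  refine h.congr' ?_
  filter_upwards [Ioo_mem_nhdsGT one_pos] with m hm
  have hb : 0 < √m := sqrt_pos.2 hm.1
  have ha : 0 < √(1 - m) := sqrt_pos.2 (sub_pos.2 hm.2)
  have ha2 : √(1 - m) ^ 2 = 1 - m := sq_sqrt (sub_pos.2 hm.2).le
  rw [ellB_one_sub_eq hm.1 hm.2, log_div (by positivity) hb.ne', log_sqrt hm.1.le]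
  have hm' : m = (1 - √(1 - m)) * (1 + √(1 - m)) := by linear_combination ha2
  have : m * log m * (1 / (2 * (1 + √(1 - m)))) = (1 - √(1 - m)) * (log m / 2) := by
    have : m * (1 / (2 * (1 + √(1 - m)))) = (1 - √(1 - m)) / 2 := by
      rw [mul_one_div, div_eq_div_iff (by positivity) two_ne_zero]
      linear_combination 2 * hm'
    linear_combination log m * this
  rw [this]
  ring

theorem hasDerivAt_ellB_div_ellA {m : ℝ} (hm0 : 0 < m) (hm : m < 1) :
    HasDerivAt (fun m => ellB (1 - m) / ellA m) (-(π / (4 * m * ellA m ^ 2))) m := by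
  have hA := one_le_ellA hm.le
  have hA0 : ellA m ≠ 0 := by linarith
  have hm1 : 1 - m ≠ 0 := (sub_pos.2 hm).ne'
  have hB1 := (hasDerivAt_ellB (m := 1 - m) (by linarith)).comp m ((hasDerivAt_id m).const_sub 1)
  refine (hB1.fun_div (hasDerivAt_ellA hm0.ne' hm) hA0).congr_deriv ?_
  have hL := ellA_mul_sub_ellB_mul hm0 hm
  simp only [Function.comp_apply, sub_sub_cancel]
  field_simp
  linear_combination -4 * hL

/-- Up to the factor `π / 2`, the exponent of `lambdaTilde`, minus its asymptotic value for a small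
parameter `m`. -/
noncomputable def ellRem (m : ℝ) : ℝ :=
  π / 2 * (ellB (1 - m) / ellA m) + 1 + log (π / 8) + log m / 2 - log (ellA m)

theorem tendsto_ellRem : Tendsto ellRem (𝓝[>] 0) (𝓝 0) := by
  have hcA : Tendsto ellA (𝓝[>] 0) (𝓝 (π / 2)) :=
    ellA_zero ▸ (continuous_ellA.tendsto 0).mono_left nhdsWithin_le_nhds
  have hlogA : Tendsto (fun m => log (ellA m)) (𝓝[>] 0) (𝓝 (log (π / 2))) :=
    hcA.log (by positivity)
  have hev : ∀ᶠ x : ℝ in 𝓝[>] 0, x ∈ Ioo (0 : ℝ) 1 := Ioo_mem_nhdsGT one_pos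
  have h1 : Tendsto (fun m => (π / 2 - ellA m) / ellA m * ellB (1 - m)) (𝓝[>] 0) (𝓝 0) := by
    have hb : Tendsto (fun m : ℝ => √m * (π ^ 2 / 8)) (𝓝[>] 0) (𝓝 0) := by
      have hc : Continuous fun m : ℝ => √m * (π ^ 2 / 8) := by fun_prop
      have := (hc.tendsto 0).mono_left (nhdsWithin_le_nhds (s := Ioi 0))
      simpa using this
    refine squeeze_zero' ?_ ?_ hb
    · filter_upwards [hev] with m hm
      have := one_le_ellA hm.2.le
      have := ellA_le hm.1.le
      have := ellB_nonneg (sub_pos.2 hm.2).le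
      exact mul_nonneg (div_nonneg (by linarith) (by linarith)) this
    · filter_upwards [hev] with m hm
      have h1 := one_le_ellA hm.2.le
      have h2 := ellA_le hm.1.le
      have h3 := pi_div_two_sub_ellA_le hm.1.le hm.2.le
      have h4 := ellB_le (sub_pos.2 hm.2).le (by linarith [hm.1])
      rw [sub_sub_cancel] at h4
      have hs : 0 < √m := sqrt_pos.2 hm.1
      have hs2 : √m ^ 2 = m := sq_sqrt hm.1.le
      have h5 : ellB (1 - m) ≤ π / 2 / √m := by
        refine h4.trans ?_
        gcongr
        nlinarith [pi_pos, hm.1]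
      have h6 : (π / 2 - ellA m) / ellA m ≤ m * (π / 4) :=
        (div_le_self (by linarith) h1).trans h3
      calc (π / 2 - ellA m) / ellA m * ellB (1 - m)
          ≤ m * (π / 4) * (π / 2 / √m) :=
            mul_le_mul h6 h5 (ellB_nonneg (sub_pos.2 hm.2).le)
              (mul_nonneg hm.1.le (by positivity))
        _ = √m * (π ^ 2 / 8) := by
            field_simp
            rw [hs2]
            ring
  have h := ((h1.add tendsto_ellB_one_sub_add_log).add_const (1 + log (π / 8))).sub hlogA
  have hval : 0 + (2 * log 2 - 1) + (1 + log (π / 8)) - log (π / 2) = 0 := by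
    have h8 : log (8 : ℝ) = 3 * log 2 := by
      rw [show (8 : ℝ) = 2 ^ 3 by norm_num, log_pow]; norm_num
    rw [log_div pi_ne_zero (by norm_num), log_div pi_ne_zero two_ne_zero, h8]
    ring
  rw [hval] at h
  refine h.congr' ?_
  filter_upwards [hev] with m hm
  have := one_le_ellA hm.2.le
  have : ellA m ≠ 0 := by linarith
  rw [ellRem, sub_div, div_self this]
  ring

theorem abs_ellRem_le {m : ℝ} (hm0 : 0 < m) (hm : m < 1) :
    |ellRem m| ≤ π ^ 4 / 32 * (m / ellA m ^ 2) := by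
  set R : ℝ → ℝ := fun m => π ^ 4 / 32 * (m / ellA m ^ 2) with hR
  set G' : ℝ → ℝ := fun m =>
    1 / (2 * m) * (1 - π ^ 2 / 4 / ellA m ^ 2 + ellB m / ellA m) with hG'
  set R' : ℝ → ℝ := fun m => π ^ 4 / 32 * (1 / ellA m ^ 2 + ellB m / ellA m ^ 3) with hR'
  have hdG : ∀ x ∈ Ioo (0 : ℝ) 1, HasDerivAt ellRem (G' x) x := by
    rintro x ⟨h0, h1⟩
    have hA : ellA x ≠ 0 := by linarith [one_le_ellA h1.le]
    refine (((((hasDerivAt_ellB_div_ellA h0 h1).const_mul (π / 2)).add_const 1).add_const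
      (log (π / 8))).fun_add ((hasDerivAt_log h0.ne').div_const 2)).fun_sub
      ((hasDerivAt_ellA h0.ne' h1).log hA) |>.congr_deriv ?_
    simp only [hG']
    field_simp
    ring
  have hdR : ∀ x ∈ Ioo (0 : ℝ) 1, HasDerivAt R (R' x) x := by
    rintro x ⟨h0, h1⟩
    have hA : ellA x ≠ 0 := by linarith [one_le_ellA h1.le]
    refine (((hasDerivAt_id x).fun_div ((hasDerivAt_ellA h0.ne' h1).fun_pow 2)
      (pow_ne_zero 2 hA)).const_mul (π ^ 4 / 32)).congr_deriv ?_
    simp only [hR', id_eq]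
    field_simp
    ring
  have hbound : ∀ x ∈ Ioo (0 : ℝ) 1, G' x ≤ R' x ∧ -G' x ≤ R' x := by
    rintro x ⟨h0, h1⟩
    have hA1 := one_le_ellA h1.le
    have hA2 := ellA_le h0.le
    have hA3 := pi_div_two_sub_ellA_le h0.le h1.le
    have hB0 := ellB_nonneg h0.le
    have hB := ellB_le_mul_add h0.le h1
    have hpi := pi_gt_three
    simp only [hG', hR']
    set A := ellA x
    set B := ellB x
    have hA : 0 < A := by linarith
    have h4 : π ^ 2 / 4 ≤ π ^ 4 / 16 := by
      have : 9 ≤ π ^ 2 := by nlinarith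
      nlinarith
    have hA2' : A ^ 2 ≤ π ^ 2 / 4 := by nlinarith
    constructor
    · have e : π ^ 4 / 32 * (1 / A ^ 2 + B / A ^ 3) -
          1 / (2 * x) * (1 - π ^ 2 / 4 / A ^ 2 + B / A) =
          (π ^ 4 / 16 * (x * (A + B)) - A * A ^ 2 + A * (π ^ 2 / 4) - B * A ^ 2) /
            (2 * x * A ^ 3) := by
        field_simp
        ring
      rw [← sub_nonneg, e]
      refine div_nonneg ?_ (by positivity)
      have t1 : A * A ^ 2 ≤ A * (π ^ 2 / 4) := by gcongr
      have t2 : B * A ^ 2 ≤ (x * (A + B)) * (π ^ 2 / 4) := by gcongr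
      have t3 : (x * (A + B)) * (π ^ 2 / 4) ≤ π ^ 4 / 16 * (x * (A + B)) := by
        have : 0 ≤ x * (A + B) := by positivity
        rw [mul_comm]
        gcongr
      linarith
    · have e : π ^ 4 / 32 * (1 / A ^ 2 + B / A ^ 3) -
          -(1 / (2 * x) * (1 - π ^ 2 / 4 / A ^ 2 + B / A)) =
          (π ^ 4 / 16 * x * (A + B) + A * (A ^ 2 - π ^ 2 / 4) + B * A ^ 2) /
            (2 * x * A ^ 3) := by
        field_simp
        ring
      rw [← sub_nonneg, e]
      refine div_nonneg ?_ (by positivity)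
      have t1 : π ^ 2 / 4 - A ^ 2 ≤ x * (π / 4) * π := by
        have : π ^ 2 / 4 - A ^ 2 = (π / 2 - A) * (π / 2 + A) := by ring
        rw [this]
        exact mul_le_mul hA3 (by linarith) (by positivity) (by positivity)
      have t2 : x * (π / 4) * π ≤ π ^ 4 / 16 * x := by
        nlinarith
      have t3 : A * (π ^ 2 / 4 - A ^ 2) ≤ A * (π ^ 4 / 16 * x) := by
        gcongr
        linarith
      have t4 : 0 ≤ π ^ 4 / 16 * x * B := by positivity
      have t5 : 0 ≤ B * A ^ 2 := by positivity
      nlinarith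
  have hlimR : Tendsto R (𝓝[>] 0) (𝓝 0) := by
    have hc : ContinuousAt R 0 := by
      refine continuousAt_const.mul (continuousAt_id.div (continuous_ellA.pow 2).continuousAt ?_)
      rw [ellA_zero]
      positivity
    have := hc.tendsto.mono_left (nhdsWithin_le_nhds (s := Ioi 0))
    simpa [hR] using this
  have key : ∀ f f' : ℝ → ℝ, (∀ x ∈ Ioo (0 : ℝ) 1, HasDerivAt f (f' x) x) →
      (∀ x ∈ Ioo (0 : ℝ) 1, 0 ≤ f' x) → Tendsto f (𝓝[>] 0) (𝓝 0) → 0 ≤ f m := by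
    intro f f' hd hn hl
    have hmono : MonotoneOn f (Ioo 0 1) := by
      refine monotoneOn_of_deriv_nonneg (convex_Ioo 0 1)
        (fun x hx => (hd x hx).continuousAt.continuousWithinAt)
        (fun x hx => (hd x (interior_subset hx)).differentiableAt.differentiableWithinAt)
        fun x hx => ?_
      rw [(hd x (interior_subset hx)).deriv]
      exact hn x (interior_subset hx)
    refine le_of_tendsto hl ?_
    filter_upwards [Ioo_mem_nhdsGT hm0] with x hx
    exact hmono ⟨hx.1, hx.2.trans hm⟩ ⟨hm0, hm⟩ hx.2.le
  have k1 := key (fun x => R x - ellRem x) (fun x => R' x - G' x)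
    (fun x hx => (hdR x hx).fun_sub (hdG x hx)) (fun x hx => sub_nonneg.2 (hbound x hx).1)
    (by simpa using hlimR.sub tendsto_ellRem)
  have k2 := key (fun x => R x + ellRem x) (fun x => R' x + G' x)
    (fun x hx => (hdR x hx).fun_add (hdG x hx)) (fun x hx => by linarith [(hbound x hx).2])
    (by simpa using hlimR.add tendsto_ellRem)
  exact abs_le.2 ⟨neg_le_iff_add_nonneg'.2 k2, sub_nonneg.1 k1⟩

theorem integral_one_div_mul_ellE_sq {k : ℝ} (hk0 : 0 < k) (hk1 : k < 1) :
    ∫ t in k..(1 : ℝ), 1 / (t * ellE t ^ 2) = 2 / π * (ellB (1 - k ^ 2) / ellA (k ^ 2)) := by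
  have hsq : ∀ t ∈ Ioo k 1, 0 < t ^ 2 ∧ t ^ 2 < 1 := fun t ht =>
    ⟨pow_pos (hk0.trans ht.1) 2, by nlinarith [ht.1, ht.2]⟩
  have hA : ∀ t ∈ Icc k 1, 0 < ellA (t ^ 2) := fun t ht => by
    linarith [one_le_ellA (m := t ^ 2) (by nlinarith [ht.1, ht.2])]
  have hd : ∀ t ∈ Ioo k 1, HasDerivAt (fun t => -(2 / π * (ellB (1 - t ^ 2) / ellA (t ^ 2))))
      (1 / (t * ellE t ^ 2)) t := by
    intro t ht
    have h := (hasDerivAt_ellB_div_ellA (hsq t ht).1 (hsq t ht).2).comp t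
      (h := fun t => t ^ 2) (hasDerivAt_pow 2 t)
    refine (h.const_mul (2 / π)).fun_neg.congr_deriv ?_
    have ht0 : t ≠ 0 := (hk0.trans ht.1).ne'
    have := (hA t ⟨ht.1.le, ht.2.le⟩).ne'
    rw [ellE_eq_ellA]
    field_simp
    norm_num
  have hc : ContinuousOn (fun t => -(2 / π * (ellB (1 - t ^ 2) / ellA (t ^ 2)))) (Icc k 1) := by
    have hcB : ContinuousOn ellB (Iio 1) := fun x hx =>
      (hasDerivAt_ellB hx).continuousAt.continuousWithinAt
    refine (continuousOn_const.mul (ContinuousOn.div ?_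
      (continuous_ellA.comp (by fun_prop)).continuousOn fun t ht => (hA t ht).ne')).neg
    refine hcB.comp (by fun_prop) fun t ht => ?_
    have : 0 < t := hk0.trans_le ht.1
    have : 0 < t ^ 2 := by positivity
    simp only [mem_Iio]
    linarith
  have hint : IntervalIntegrable (fun t => 1 / (t * ellE t ^ 2)) volume k 1 := by
    refine ContinuousOn.intervalIntegrable ?_
    rw [uIcc_of_le hk1.le]
    simp only [ellE_eq_ellA]
    refine ContinuousOn.div (by fun_prop) (continuousOn_id.mul
      ((continuous_ellA.comp (by fun_prop)).pow 2).continuousOn) fun t ht => ?_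
    exact mul_ne_zero (hk0.trans_le ht.1).ne' (pow_ne_zero 2 (hA t ht).ne')
  rw [intervalIntegral.integral_eq_sub_of_hasDerivAt_of_le hk1.le hc hd hint]
  simp [ellB]

theorem PhiFn_spec {x : ℝ} (hx0 : 0 < x) (hx1 : x < 1) :
    0 < PhiFn x ∧ PhiFn x < 1 ∧ PsiFn (PhiFn x) = x := by
  set S := {y : ℝ | y ∈ Icc (0 : ℝ) 1 ∧ PsiFn y ≤ x} with hS
  have hcont : ContinuousOn PsiFn (Icc 0 1) := by
    have : PsiFn = fun k => k / ellA (k ^ 2) := by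
      funext k; rw [PsiFn, ellE_eq_ellA]
    rw [this]
    refine continuousOn_id.div (continuous_ellA.comp (by fun_prop)).continuousOn fun t ht => ?_
    linarith [one_le_ellA (m := t ^ 2) (by nlinarith [ht.1, ht.2])]
  have h0 : PsiFn 0 = 0 := by simp [PsiFn]
  have h1 : PsiFn 1 = 1 := by simp [PsiFn, ellE_eq_ellA, ellA_one]
  have hclosed : IsClosed S := hcont.preimage_isClosed_of_isClosed isClosed_Icc isClosed_Iic
  have hbdd : BddAbove S := ⟨1, fun y hy => hy.1.2⟩
  have hmem : sSup S ∈ S := hclosed.csSup_mem ⟨0, by simp, by rw [h0]; exact hx0.le⟩ hbdd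
  have hPhi : PhiFn x = sSup S := rfl
  rw [hPhi]
  have hlt : sSup S < 1 := lt_of_le_of_ne hmem.1.2 fun h => by
    have := hmem.2
    rw [h, h1] at this
    linarith
  have heq : PsiFn (sSup S) = x := by
    obtain ⟨y, hy, hyx⟩ := intermediate_value_Icc hlt.le
      (hcont.mono (Icc_subset_Icc_left hmem.1.1)) ⟨hmem.2, hx1.le.trans_eq h1.symm⟩
    have hyS : y ∈ S := ⟨⟨hmem.1.1.trans hy.1, hy.2⟩, hyx.le⟩
    rw [le_antisymm hy.1 (le_csSup hbdd hyS), hyx]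
  refine ⟨lt_of_le_of_ne hmem.1.1 fun h => ?_, hlt, heq⟩
  rw [← h, h0] at heq
  linarith

theorem stmt5 (n : ℕ) (c : ℝ) (hc : 0 < c) (hc2 : c < Real.pi * ((n:ℝ)+1/2) / 2) :
    (1/2) * (Real.exp 1 * c / (4*((n:ℝ)+1/2)))^(2*n+1) *
        Real.exp (-(Real.pi^2 * c^2 / (4*((n:ℝ)+1/2)))) ≤ lambdaTilde n c ∧
    lambdaTilde n c ≤ (1/2) * (Real.exp 1 * c / (4*((n:ℝ)+1/2)))^(2*n+1) *
        Real.exp (Real.pi^2 * c^2 / (4*((n:ℝ)+1/2))) := by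
  set l : ℝ := (n : ℝ) + 1 / 2 with hl
  have hl0 : 0 < l := by positivity
  set x : ℝ := 2 * c / (π * l) with hx
  have hx0 : 0 < x := by positivity
  have hx1 : x < 1 := by
    rw [hx, div_lt_one (by positivity)]
    linarith
  have hcx : c = x * (π * l) / 2 := by
    rw [hx]
    field_simp
  obtain ⟨hk0, hk1, hk⟩ := PhiFn_spec hx0 hx1
  set k := PhiFn x
  have hk20 : 0 < k ^ 2 := by positivity
  have hk21 : k ^ 2 < 1 := by nlinarith
  have hA : 0 < ellA (k ^ 2) := by linarith [one_le_ellA hk21.le]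
  rw [PsiFn, ellE_eq_ellA] at hk
  have hrem := abs_ellRem_le hk20 hk21
  rw [← div_pow, hk, abs_le] at hrem
  have hbase : 0 < exp 1 * c / (4 * l) := by positivity
  have hlog : log (exp 1 * c / (4 * l)) =
      1 + log (π / 8) + log (k ^ 2) / 2 - log (ellA (k ^ 2)) := by
    have : exp 1 * c / (4 * l) = exp 1 * (π / 8) * (k / ellA (k ^ 2)) := by
      rw [hk, hcx]
      field_simp
      ring
    rw [this, log_mul (by positivity) (by positivity), log_mul (by positivity) (by positivity),
      log_exp, log_div hk0.ne' hA.ne', log_pow]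
    push_cast
    ring
  have hpow : (exp 1 * c / (4 * l)) ^ (2 * n + 1) = exp (2 * l * log (exp 1 * c / (4 * l))) := by
    rw [← exp_log (pow_pos hbase (2 * n + 1)), log_pow]
    congr 2
    push_cast
    rw [hl]
    ring
  have hexp : -(π ^ 2 * l / 2) * ∫ t in k..(1 : ℝ), 1 / (t * ellE t ^ 2) =
      2 * l * log (exp 1 * c / (4 * l)) - 2 * l * ellRem (k ^ 2) := by
    rw [integral_one_div_mul_ellE_sq hk0 hk1, hlog, ellRem]
    field_simp
    ring
  have hquad : π ^ 2 * c ^ 2 / (4 * l) = 2 * l * (π ^ 4 / 32 * x ^ 2) := by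
    rw [hcx]
    field_simp
    ring
  rw [lambdaTilde, ← hl, ← hx, hexp, hpow, hquad, mul_assoc (1 / 2 : ℝ), mul_assoc (1 / 2 : ℝ),
    ← exp_add, ← exp_add]
  have h2l : 0 ≤ 2 * l := by positivity
  have hlo := mul_le_mul_of_nonneg_left hrem.1 h2l
  have hhi := mul_le_mul_of_nonneg_left hrem.2 h2l
  constructor
  · gcongr
    linarith
  · gcongr
    linarith
end

section
/- For every real x with 0 < x < π/2, one has max(0, ln(1/x)) ≤ 𝒥(x) ≤ (π²/4) · ln(π/(2x)), where 𝒥(x) = (π²/4) ∫_{Φ(2x/π)}^{1} dt/(t·E(t)²). -/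
open MeasureTheory

lemma intervalIntegrable_one_div_sqrt_one_sub_sq :
    IntervalIntegrable (fun t : ℝ => 1 / Real.sqrt (1 - t ^ 2)) volume 0 1 := by
  refine intervalIntegral.intervalIntegrable_deriv_of_nonneg (g := Real.arcsin)
    Real.continuous_arcsin.continuousOn (fun t ht => ?_) (fun t _ => by positivity)
  rw [min_eq_left zero_le_one, max_eq_right zero_le_one] at ht
  exact Real.hasDerivAt_arcsin (by linarith [ht.1]) ht.2.ne

lemma integral_one_div_sqrt_one_sub_sq :
    ∫ t in (0:ℝ)..1, 1 / Real.sqrt (1 - t ^ 2) = Real.pi / 2 := by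
  rw [intervalIntegral.integral_eq_sub_of_hasDerivAt_of_le zero_le_one
    Real.continuous_arcsin.continuousOn
    (fun t ht => Real.hasDerivAt_arcsin (by linarith [ht.1]) ht.2.ne)
    intervalIntegrable_one_div_sqrt_one_sub_sq, Real.arcsin_one, Real.arcsin_zero, sub_zero]

lemma sqrt_ellE_integrand_le {t : ℝ} (ht : t ∈ Set.Icc (0:ℝ) 1) (k : ℝ) :
    Real.sqrt ((1 - k ^ 2 * t ^ 2) / (1 - t ^ 2)) ≤ 1 / Real.sqrt (1 - t ^ 2) := by
  rw [← Real.sqrt_one, ← Real.sqrt_div zero_le_one, Real.sqrt_one]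
  have h : 0 ≤ 1 - t ^ 2 := by nlinarith [ht.1, ht.2]
  gcongr
  nlinarith [mul_nonneg (sq_nonneg k) (sq_nonneg t)]

lemma intervalIntegrable_ellE_integrand (k : ℝ) :
    IntervalIntegrable (fun t : ℝ => Real.sqrt ((1 - k ^ 2 * t ^ 2) / (1 - t ^ 2)))
      volume 0 1 := by
  refine intervalIntegrable_one_div_sqrt_one_sub_sq.mono_fun'
    (Measurable.aestronglyMeasurable (by fun_prop)) ?_
  refine (ae_restrict_iff' measurableSet_uIoc).2 (Filter.Eventually.of_forall fun t ht => ?_)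
  rw [Set.uIoc_of_le zero_le_one] at ht
  dsimp only
  rw [Real.norm_of_nonneg (Real.sqrt_nonneg _)]
  exact sqrt_ellE_integrand_le ⟨ht.1.le, ht.2⟩ k

lemma ellE_le_pi_div_two (k : ℝ) : ellE k ≤ Real.pi / 2 := by
  rw [← integral_one_div_sqrt_one_sub_sq]
  exact intervalIntegral.integral_mono_on zero_le_one (intervalIntegrable_ellE_integrand k)
    intervalIntegrable_one_div_sqrt_one_sub_sq fun t ht => sqrt_ellE_integrand_le ht k

lemma one_le_ellE {k : ℝ} (hk : k ∈ Set.Icc (0:ℝ) 1) : 1 ≤ ellE k := by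
  have h : ∫ _ in (0:ℝ)..1, (1:ℝ) ≤ ellE k := by
    refine intervalIntegral.integral_mono_on_of_le_Ioo zero_le_one
      intervalIntegrable_const (intervalIntegrable_ellE_integrand k) fun t ht => ?_
    have hpos : 0 < 1 - t ^ 2 := by nlinarith [ht.1, ht.2]
    have hk2 : k ^ 2 ≤ 1 := by nlinarith [hk.1, hk.2]
    rw [Real.one_le_sqrt, one_le_div hpos]
    nlinarith [mul_le_mul_of_nonneg_right hk2 (sq_nonneg t)]
  simpa using h

lemma ellE_antitoneOn : AntitoneOn ellE (Set.Icc 0 1) := by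
  intro a ha b hb hab
  refine intervalIntegral.integral_mono_on zero_le_one (intervalIntegrable_ellE_integrand b)
    (intervalIntegrable_ellE_integrand a) fun t ht => ?_
  have h : 0 ≤ 1 - t ^ 2 := by nlinarith [ht.1, ht.2]
  have := ha.1
  gcongr

lemma intervalIntegrable_one_div_mul_ellE_sq {a : ℝ} (ha : 0 < a) (ha1 : a ≤ 1) :
    IntervalIntegrable (fun t : ℝ => 1 / (t * (ellE t) ^ 2)) volume a 1 := by
  have hmono : MonotoneOn (fun t : ℝ => 1 / (ellE t) ^ 2) (Set.uIcc a 1) := by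
    rw [Set.uIcc_of_le ha1]
    intro s hs t ht hst
    have hs' : s ∈ Set.Icc (0:ℝ) 1 := ⟨ha.le.trans hs.1, hs.2⟩
    have ht' : t ∈ Set.Icc (0:ℝ) 1 := ⟨ha.le.trans ht.1, ht.2⟩
    have h1 := one_le_ellE ht'
    have h2 := ellE_antitoneOn hs' ht' hst
    dsimp only
    gcongr
  have hcont : ContinuousOn (fun t : ℝ => 1 / t) (Set.uIcc a 1) := by
    rw [Set.uIcc_of_le ha1]
    exact continuousOn_const.div continuousOn_id fun t ht => (ha.trans_le ht.1).ne'
  refine (hmono.intervalIntegrable.continuousOn_mul hcont).congr fun t _ => ?_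
  simp only [one_div, mul_inv]

lemma PhiFn_mem_Icc {y : ℝ} (hy : y ∈ Set.Icc (0:ℝ) 1) :
    PhiFn y ∈ Set.Icc y (min 1 (Real.pi / 2 * y)) := by
  have hmem : y ∈ {z : ℝ | z ∈ Set.Icc (0:ℝ) 1 ∧ PsiFn z ≤ y} :=
    ⟨hy, div_le_self hy.1 (one_le_ellE hy)⟩
  refine ⟨le_csSup ⟨1, fun z hz => hz.1.2⟩ hmem, csSup_le ⟨y, hmem⟩ fun z hz => ?_⟩
  refine le_min hz.1.2 ?_
  have h := (div_le_iff₀ (zero_lt_one.trans_le (one_le_ellE hz.1))).1 hz.2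
  nlinarith [mul_le_mul_of_nonneg_left (ellE_le_pi_div_two z) hy.1]

lemma integral_one_div_mul_ellE_sq_le {a : ℝ} (ha : 0 < a) (ha1 : a ≤ 1) :
    ∫ t in a..(1:ℝ), 1 / (t * (ellE t) ^ 2) ≤ Real.log (1 / a) := by
  rw [← integral_one_div_of_pos ha zero_lt_one]
  refine intervalIntegral.integral_mono_on ha1 (intervalIntegrable_one_div_mul_ellE_sq ha ha1)
    (intervalIntegral.intervalIntegrable_one_div
      (fun t ht => ?_) continuousOn_id) fun t ht => ?_
  · rw [Set.uIcc_of_le ha1] at ht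
    exact (ha.trans_le ht.1).ne'
  · have h0 : 0 < t := ha.trans_le ht.1
    have h1 := one_le_ellE ⟨h0.le, ht.2⟩
    gcongr
    exact le_mul_of_one_le_right h0.le (one_le_pow₀ h1)

lemma log_le_integral_one_div_mul_ellE_sq {a : ℝ} (ha : 0 < a) (ha1 : a ≤ 1) :
    Real.log (1 / a) ≤ Real.pi ^ 2 / 4 * ∫ t in a..(1:ℝ), 1 / (t * (ellE t) ^ 2) := by
  rw [← integral_one_div_of_pos ha zero_lt_one, ← intervalIntegral.integral_const_mul]
  refine intervalIntegral.integral_mono_on ha1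
    (intervalIntegral.intervalIntegrable_one_div (fun t ht => ?_) continuousOn_id)
    ((intervalIntegrable_one_div_mul_ellE_sq ha ha1).const_mul _) fun t ht => ?_
  · rw [Set.uIcc_of_le ha1] at ht
    exact (ha.trans_le ht.1).ne'
  · have h0 : 0 < t := ha.trans_le ht.1
    have h1 := one_le_ellE ⟨h0.le, ht.2⟩
    have h2 := ellE_le_pi_div_two t
    have h3 : ellE t ^ 2 ≤ Real.pi ^ 2 / 4 := by nlinarith
    rw [mul_one_div, div_le_div_iff₀ h0 (by positivity)]
    nlinarith [mul_le_mul_of_nonneg_left h3 h0.le]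

theorem stmt6 (x : ℝ) (hx : 0 < x) (hx2 : x < Real.pi / 2) :
    max 0 (Real.log (1/x)) ≤ Jcal x ∧ Jcal x ≤ (Real.pi^2/4) * Real.log (Real.pi/(2*x)) := by
  have hpi := Real.pi_pos
  have hy : 2 * x / Real.pi ∈ Set.Icc (0:ℝ) 1 :=
    ⟨by positivity, by rw [div_le_one hpi]; linarith⟩
  obtain ⟨hle, hge⟩ := PhiFn_mem_Icc hy
  obtain ⟨h1, hx'⟩ := le_min_iff.1 hge
  rw [show Real.pi / 2 * (2 * x / Real.pi) = x by field_simp] at hx'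
  have h0 : 0 < PhiFn (2 * x / Real.pi) := lt_of_lt_of_le (by positivity) hle
  have hlow := log_le_integral_one_div_mul_ellE_sq h0 h1
  refine ⟨max_le (le_trans (Real.log_nonneg (by rwa [one_le_div h0])) hlow)
    (le_trans (Real.log_le_log (by positivity) (by gcongr)) hlow), ?_⟩
  refine mul_le_mul_of_nonneg_left ((integral_one_div_mul_ellE_sq_le h0 h1).trans ?_)
    (by positivity)
  refine Real.log_le_log (by positivity) ?_
  rw [← one_div_div (2 * x) Real.pi]
  gcongr
end
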